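/- arXiv:2405.17819 — 2 statements merged into one kernel-verified Lean document; each statement's English description precedes it below -/
import Mathlib

section
/- Let G be a (P2+P3, gem)-free graph. If G contains an induced F1', then either G belongs to the class 𝒞 or χ(G) ≤ ω(G) + 1. -/
open SimpleGraph

/-- The graph `P2 + P3` (disjoint union of a path on 2 and a path on 3 vertices). -/
def graphP2P3 : SimpleGraph (Fin 5) :=
  SimpleGraph.fromRel (fun x y => (x, y) ∈ ([(0,1),(2,3),(3,4)] : List (Fin 5 × Fin 5)))

/-- The gem: a path `P4` (0-1-2-3) plus a vertex 4 adjacent to all of it. -/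
def graphGem : SimpleGraph (Fin 5) :=
  SimpleGraph.fromRel (fun x y =>
    (x, y) ∈ ([(0,1),(1,2),(2,3),(4,0),(4,1),(4,2),(4,3)] : List (Fin 5 × Fin 5)))

/-- The path on three vertices. -/
def graphP3 : SimpleGraph (Fin 3) :=
  SimpleGraph.fromRel (fun x y => (x, y) ∈ ([(0,1),(1,2)] : List (Fin 3 × Fin 3)))

/-- The cycle on five vertices. -/
def graphC5 : SimpleGraph (Fin 5) :=
  SimpleGraph.fromRel (fun x y => y = x + 1)

/-- `F1`: a 5-cycle `v1 v2 v3 v4 v5` (vertices 0..4) plus a vertex 5 adjacent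
exactly to `v5, v1, v2` (i.e. 4, 0, 1). -/
def graphF1 : SimpleGraph (Fin 6) :=
  SimpleGraph.fromRel (fun x y =>
    (x, y) ∈ ([(0,1),(1,2),(2,3),(3,4),(4,0),(5,4),(5,0),(5,1)] : List (Fin 6 × Fin 6)))

/-- `F1'`: a 5-cycle (0..4) plus adjacent vertices 5, 6, where 5 is adjacent to 4,0,1
and 6 is adjacent to 0,1,2. -/
def graphF1' : SimpleGraph (Fin 7) :=
  SimpleGraph.fromRel (fun x y =>
    (x, y) ∈ ([(0,1),(1,2),(2,3),(3,4),(4,0),(5,4),(5,0),(5,1),(6,0),(6,1),(6,2),(5,6)] :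
      List (Fin 7 × Fin 7)))

/-- `F1''`: a 5-cycle (0..4) plus nonadjacent vertices 5, 6, where 5 is adjacent to 4,0,1
and 6 is adjacent to 1,2,3. -/
def graphF1'' : SimpleGraph (Fin 7) :=
  SimpleGraph.fromRel (fun x y =>
    (x, y) ∈ ([(0,1),(1,2),(2,3),(3,4),(4,0),(5,4),(5,0),(5,1),(6,1),(6,2),(6,3)] :
      List (Fin 7 × Fin 7)))

/-- `F2`: a 5-cycle (0..4) plus adjacent vertices 5, 6, each adjacent to `v1,v3,v4`
(i.e. 0, 2, 3). -/
def graphF2 : SimpleGraph (Fin 7) :=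
  SimpleGraph.fromRel (fun x y =>
    (x, y) ∈ ([(0,1),(1,2),(2,3),(3,4),(4,0),(5,6),(5,0),(5,2),(5,3),(6,0),(6,2),(6,3)] :
      List (Fin 7 × Fin 7)))

/-- `F3`: a 5-cycle (0..4) plus adjacent vertices 5 (adjacent to 0,2,3) and
6 (adjacent to 2,3). -/
def graphF3 : SimpleGraph (Fin 7) :=
  SimpleGraph.fromRel (fun x y =>
    (x, y) ∈ ([(0,1),(1,2),(2,3),(3,4),(4,0),(5,6),(5,0),(5,2),(5,3),(6,2),(6,3)] :
      List (Fin 7 × Fin 7)))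

/-- `G` contains no induced copy of `H`. -/
def IsFreeOf {W V : Type*} (G : SimpleGraph V) (H : SimpleGraph W) : Prop :=
  IsEmpty (H ↪g G)

/-- The disjoint union of a clique blowup `C5⟨K_{t 0},…,K_{t 4}⟩` of the 5-cycle and
`ℓ` isolated vertices. -/
def blowupC5 (t : Fin 5 → ℕ) (ℓ : ℕ) :
    SimpleGraph ((Σ i : Fin 5, Fin (t i)) ⊕ Fin ℓ) :=
  SimpleGraph.fromRel (fun x y => ∃ a b, x = Sum.inl a ∧ y = Sum.inl b ∧
    (a.1 = b.1 ∨ b.1 = a.1 + 1))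

/-- Membership in the class `𝒞`: `G` is isomorphic to the disjoint union of a clique
blowup of `C5` and some number of isolated vertices. -/
def InClassC {V : Type*} (G : SimpleGraph V) : Prop :=
  ∃ (t : Fin 5 → ℕ) (ℓ : ℕ), (∀ i, 0 < t i) ∧ Nonempty (G ≃g blowupC5 t ℓ)

/-- The function φ from the paper. -/
noncomputable def phi (x : ℕ) : ℕ :=
  if x = 1 then 1 else if x = 2 then 4 else if x = 3 then 6
  else ⌈(5 * (x : ℚ) - 1) / 4⌉₊

section Stmt
variable {V : Type*} (G : SimpleGraph V)

/-- `S` is complete to `S'`. -/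
def CompleteTo (S S' : Set V) : Prop := ∀ x ∈ S, ∀ y ∈ S', G.Adj x y

/-- `S` is anticomplete to `S'`. -/
def AnticompleteTo (S S' : Set V) : Prop := ∀ x ∈ S, ∀ y ∈ S', ¬ G.Adj x y

/-- `S` is a stable (independent) set. -/
def IsStableSet (S : Set V) : Prop := S.Pairwise (fun x y => ¬ G.Adj x y)

/-- A graph is perfect if every induced subgraph has chromatic number equal to
its clique number. -/
def IsPerfect : Prop :=
  ∀ S : Set V, (G.induce S).chromaticNumber = ((G.induce S).cliqueNum : ℕ∞)

variable (v : Fin 5 → V)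

/-- `v` induces a `C5` in `G`: two cycle vertices are adjacent iff consecutive. -/
def IsInducedC5 : Prop :=
  Function.Injective v ∧ ∀ i j : Fin 5, G.Adj (v i) (v j) ↔ (j = i + 1 ∨ i = j + 1)

def setA (i : Fin 5) : Set V :=
  {u | u ∉ Set.range v ∧ ∀ j, G.Adj u (v j) ↔ j = i}

def setB (i : Fin 5) : Set V :=
  {u | u ∉ Set.range v ∧ ∀ j, G.Adj u (v j) ↔ (j = i ∨ j = i + 1)}

def setX (i : Fin 5) : Set V :=
  {u | u ∉ Set.range v ∧ ∀ j, G.Adj u (v j) ↔ (j = i - 1 ∨ j = i + 1)}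

def setY (i : Fin 5) : Set V :=
  {u | u ∉ Set.range v ∧ ∀ j, G.Adj u (v j) ↔ (j = i - 1 ∨ j = i ∨ j = i + 1)}

def setZ (i : Fin 5) : Set V :=
  {u | u ∉ Set.range v ∧ ∀ j, G.Adj u (v j) ↔ (j = i - 2 ∨ j = i ∨ j = i + 2)}

def setT : Set V :=
  {u | u ∉ Set.range v ∧ ∀ j, ¬ G.Adj u (v j)}

end Stmt

namespace GemFree

open Finset

/-- There is no induced gem with hub `e` and path `a b c d`. -/
def NoGem {V : Type*} (G : SimpleGraph V) : Prop :=
  ∀ e a b c d, G.Adj a b → G.Adj b c → G.Adj c d → G.Adj e a → G.Adj e b → G.Adj e c →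
    G.Adj e d → ¬ G.Adj a c → ¬ G.Adj a d → ¬ G.Adj b d → False

/-- There is no induced `P2 + P3` with edge `a b` and path `x y z`. -/
def NoP2P3 {V : Type*} (G : SimpleGraph V) : Prop :=
  ∀ a b x y z, G.Adj a b → G.Adj x y → G.Adj y z → x ≠ z → ¬ G.Adj x z →
    ¬ G.Adj a x → ¬ G.Adj a y → ¬ G.Adj a z → ¬ G.Adj b x → ¬ G.Adj b y → ¬ G.Adj b z → False

lemma noGem_of_isFreeOf {V : Type*} {G : SimpleGraph V} (h : IsFreeOf G graphGem) :
    NoGem G := by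
  intro e a b c d hab hbc hcd hea heb hec hed hac had hbd
  have hac' : a ≠ c := by rintro rfl; exact had hcd
  have had' : a ≠ d := by rintro rfl; exact hbd hab.symm
  have hbd' : b ≠ d := by rintro rfl; exact had hab
  refine h.false ⟨⟨![a, b, c, d, e], ?_⟩, ?_⟩
  · intro i j hij
    fin_cases i <;> fin_cases j <;>
      simp [hab.ne, hbc.ne, hcd.ne, hea.ne, heb.ne, hec.ne, hed.ne, hab.ne', hbc.ne', hcd.ne',
        hea.ne', heb.ne', hec.ne', hed.ne', hac', had', hbd', hac'.symm, had'.symm,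
        hbd'.symm] at hij ⊢
  · intro i j
    change G.Adj (![a, b, c, d, e] i) (![a, b, c, d, e] j) ↔ graphGem.Adj i j
    fin_cases i <;> fin_cases j <;>
      simp [graphGem, hab, hbc, hcd, hea, heb, hec, hed, hac, had, hbd, hab.symm, hbc.symm,
        hcd.symm, hea.symm, heb.symm, hec.symm, hed.symm, G.adj_comm c a, G.adj_comm d a,
        G.adj_comm d b]

lemma noP2P3_of_isFreeOf {V : Type*} {G : SimpleGraph V} (h : IsFreeOf G graphP2P3) :
    NoP2P3 G := by
  intro a b x y z hab hxy hyz hxz nxz nax nay naz nbx nby nbz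
  have hax : a ≠ x := by rintro rfl; exact nay hxy
  have hay : a ≠ y := by rintro rfl; exact naz hyz
  have haz : a ≠ z := by rintro rfl; exact nay hyz.symm
  have hbx : b ≠ x := by rintro rfl; exact nby hxy
  have hby : b ≠ y := by rintro rfl; exact nbz hyz
  have hbz : b ≠ z := by rintro rfl; exact nby hyz.symm
  refine h.false ⟨⟨![a, b, x, y, z], ?_⟩, ?_⟩
  · intro i j hij
    fin_cases i <;> fin_cases j <;>
      simp [hab.ne, hxy.ne, hyz.ne, hxz, hax, hay, haz, hbx, hby, hbz, hab.ne', hxy.ne', hyz.ne',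
        hxz.symm, hax.symm, hay.symm, haz.symm, hbx.symm, hby.symm, hbz.symm] at hij ⊢
  · intro i j
    change G.Adj (![a, b, x, y, z] i) (![a, b, x, y, z] j) ↔ graphP2P3.Adj i j
    fin_cases i <;> fin_cases j <;>
      simp [graphP2P3, hab, hxy, hyz, nxz, nax, nay, naz, nbx, nby, nbz, hab.symm, hxy.symm,
        hyz.symm, G.adj_comm z x, G.adj_comm x a, G.adj_comm y a, G.adj_comm z a,
        G.adj_comm x b, G.adj_comm y b, G.adj_comm z b]

section ColorableOn

variable {V : Type*} {G : SimpleGraph V}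

/-- The vertices of `S` can be properly coloured with `n` colours. -/
def ColorableOn (G : SimpleGraph V) (S : Finset V) (n : ℕ) : Prop :=
  ∃ f : V → ℕ, (∀ v ∈ S, f v < n) ∧ ∀ u ∈ S, ∀ v ∈ S, G.Adj u v → f u ≠ f v

lemma ColorableOn.mono {S S' : Finset V} {n m : ℕ} (h : ColorableOn G S n) (hS : S' ⊆ S)
    (hn : n ≤ m) : ColorableOn G S' m := by
  obtain ⟨f, hf, hf'⟩ := h
  exact ⟨f, fun v hv => (hf v (hS hv)).trans_le hn, fun u hu v hv => hf' u (hS hu) v (hS hv)⟩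

lemma colorableOn_empty (n : ℕ) : ColorableOn G ∅ n := ⟨fun _ => 0, by simp, by simp⟩

lemma colorableOn_one {S : Finset V} (h : ∀ u ∈ S, ∀ v ∈ S, ¬ G.Adj u v) :
    ColorableOn G S 1 := ⟨fun _ => 0, by simp, fun u hu v hv huv => (h u hu v hv huv).elim⟩

lemma ColorableOn.chromaticNumber_le [Fintype V] {n : ℕ} (h : ColorableOn G univ n) :
    G.chromaticNumber ≤ n := by
  obtain ⟨f, hf, hf'⟩ := h
  refine Colorable.chromaticNumber_le ⟨Coloring.mk (fun v => ⟨f v, hf v (mem_univ _)⟩) ?_⟩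
  intro u v huv e
  exact hf' u (mem_univ _) v (mem_univ _) huv (by simpa using e)

variable [DecidableEq V]

lemma ColorableOn.union_anti {S S' : Finset V} {n : ℕ} (h : ColorableOn G S n)
    (h' : ColorableOn G S' n) (ha : ∀ u ∈ S, ∀ v ∈ S', ¬ G.Adj u v) :
    ColorableOn G (S ∪ S') n := by
  obtain ⟨f, hf, hf'⟩ := h
  obtain ⟨g, hg, hg'⟩ := h'
  refine ⟨fun v => if v ∈ S then f v else g v, ?_, ?_⟩
  · intro v hv
    grind
  · intro u hu v hv huv
    have := huv.symm
    grind

lemma ColorableOn.union {S S' : Finset V} {n m : ℕ} (h : ColorableOn G S n)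
    (h' : ColorableOn G S' m) : ColorableOn G (S ∪ S') (n + m) := by
  obtain ⟨f, hf, hf'⟩ := h
  obtain ⟨g, hg, hg'⟩ := h'
  refine ⟨fun v => if v ∈ S then f v else n + g v, ?_, ?_⟩
  · intro v hv
    grind
  · intro u hu v hv huv
    grind

lemma colorableOn_card (S : Finset V) : ColorableOn G S S.card := by
  induction S using Finset.induction_on with
  | empty => exact colorableOn_empty _
  | insert a S ha ih =>
    rw [card_insert_of_notMem ha, insert_eq, union_comm]
    exact ih.union (colorableOn_one (by simp))

/-- Vertices with fewer than `n` neighbours can be coloured greedily. -/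
lemma ColorableOn.extend {S : Finset V} {n : ℕ} (h : ColorableOn G S n) (R : Finset V)
    (hR : ∀ u ∈ R, ∃ N : Finset V, (∀ v, G.Adj u v → v ∈ N) ∧ N.card < n) :
    ColorableOn G (S ∪ R) n := by
  induction R using Finset.induction_on with
  | empty => simpa using h
  | insert a R ha ih =>
    obtain ⟨f, hf, hf'⟩ := ih fun u hu => hR u (mem_insert_of_mem hu)
    obtain ⟨N, hN, hc⟩ := hR a (mem_insert_self _ _)
    obtain ⟨c, hc, hcN⟩ : ∃ c ∈ range n, c ∉ N.image f :=
      exists_mem_notMem_of_card_lt_card (by simpa using card_image_le.trans_lt hc)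
    have hne : ∀ v, G.Adj a v → f v ≠ c := fun v hv e =>
      hcN (mem_image.2 ⟨v, hN v hv, e⟩)
    rw [union_insert]
    refine ⟨fun v => if v = a then c else f v, ?_, ?_⟩
    · intro v hv
      grind
    · intro u hu v hv huv
      have := huv.symm
      have := huv.ne
      grind

/-- A graph without induced `P4` is perfect: it can be coloured with as many colours as the
size of its largest clique. -/
lemma colorableOn_of_noP4 {n : ℕ} : ∀ {S : Finset V},
    (∀ a ∈ S, ∀ b ∈ S, ∀ c ∈ S, ∀ d ∈ S, G.Adj a b → G.Adj b c → G.Adj c d →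
      ¬ G.Adj a c → ¬ G.Adj a d → ¬ G.Adj b d → False) →
    (∀ K ⊆ S, G.IsClique (K : Set V) → K.card ≤ n) → ColorableOn G S n := by
  classical
  induction n with
  | zero =>
    intro S _ hK
    obtain rfl : S = ∅ := by
      by_contra hS
      obtain ⟨x, hx⟩ := nonempty_iff_ne_empty.2 hS
      simpa using hK {x} (by simpa using hx) (by simp)
    exact colorableOn_empty _
  | succ n ih =>
    intro S hP hK
    obtain ⟨M, hM, hmax⟩ := exists_max_image
      (S.powerset.filter fun M => ∀ u ∈ M, ∀ v ∈ M, ¬ G.Adj u v) card ⟨∅, by simp⟩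
    simp only [mem_filter, mem_powerset] at hM hmax
    obtain ⟨hMS, hst⟩ := hM
    have hnb : ∀ x ∈ S, x ∉ M → ∃ s ∈ M, G.Adj x s := by
      intro x hx hxM
      by_contra! hno
      have := hmax (insert x M) ⟨by grind, by
        intro u hu v hv huv
        have := huv.symm
        have := huv.ne
        grind⟩
      rw [card_insert_of_notMem hxM] at this
      omega
    have hrec : ColorableOn G (S \ M) n := by
      refine ih (fun a ha b hb c hc d hd => hP a (by grind) b (by grind) c (by grind) d (by grind))
        ?_
      intro K hKS hKc
      by_contra! hcard
      have hne : K.Nonempty := card_pos.1 (by omega)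
      obtain ⟨k, hk⟩ := hne
      have hMne : M.Nonempty := by
        obtain ⟨s, hs, -⟩ := hnb k (by grind) (by grind)
        exact ⟨s, hs⟩
      obtain ⟨s, hs, hsmax⟩ := exists_max_image M (fun s => (K.filter (G.Adj s)).card) hMne
      by_cases hall : ∀ x ∈ K, G.Adj s x
      · have h1 := hK (insert s K) (by grind) (by
          rw [coe_insert]
          exact hKc.insert fun b hb _ => hall b hb)
        rw [card_insert_of_notMem (by grind)] at h1
        omega
      · push Not at hall
        obtain ⟨x, hx, hsx⟩ := hall
        obtain ⟨s', hs', hxs'⟩ := hnb x (by grind) (by grind)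
        obtain ⟨y, hy, hys'⟩ : ∃ y ∈ K.filter (G.Adj s), y ∉ K.filter (G.Adj s') := by
          by_contra! hsub
          have := card_lt_card (s := K.filter (G.Adj s)) (t := K.filter (G.Adj s'))
            ⟨hsub, fun h => hsx (mem_filter.1 (h (mem_filter.2 ⟨hx, hxs'.symm⟩))).2⟩
          have := hsmax s' hs'
          omega
        simp only [mem_filter, not_and] at hy hys'
        have hyx : y ≠ x := by rintro rfl; exact hsx hy.2
        exact hP s (hMS hs) y (by grind) x (by grind) s' (hMS hs') hy.2 (hKc hy.1 hx hyx) hxs'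
          hsx (hst s hs s' hs') fun h => hys' hy.1 h.symm
    have := hrec.union (colorableOn_one hst)
    rwa [sdiff_union_of_subset hMS] at this

end ColorableOn

/-- The cliques `A, B, C, D, E` induce a clique blowup of `C5` in the (P2+P3, gem)-free graph `G`,
and `A` and `B` have at least two vertices. -/
structure Blow {V : Type*} (G : SimpleGraph V) (A B C D E : Finset V) : Prop where
  gem : NoGem G
  pp : NoP2P3 G
  cardA : 1 < A.card
  cardB : 1 < B.card
  neC : C.Nonempty
  neD : D.Nonempty
  neE : E.Nonempty
  cliqueA : ∀ x ∈ A, ∀ y ∈ A, x ≠ y → G.Adj x y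
  cliqueB : ∀ x ∈ B, ∀ y ∈ B, x ≠ y → G.Adj x y
  cliqueC : ∀ x ∈ C, ∀ y ∈ C, x ≠ y → G.Adj x y
  cliqueD : ∀ x ∈ D, ∀ y ∈ D, x ≠ y → G.Adj x y
  cliqueE : ∀ x ∈ E, ∀ y ∈ E, x ≠ y → G.Adj x y
  adjAB : ∀ x ∈ A, ∀ y ∈ B, G.Adj x y
  adjBC : ∀ x ∈ B, ∀ y ∈ C, G.Adj x y
  adjCD : ∀ x ∈ C, ∀ y ∈ D, G.Adj x y
  adjDE : ∀ x ∈ D, ∀ y ∈ E, G.Adj x y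
  adjEA : ∀ x ∈ E, ∀ y ∈ A, G.Adj x y
  antiAC : ∀ x ∈ A, ∀ y ∈ C, ¬ G.Adj x y
  antiAD : ∀ x ∈ A, ∀ y ∈ D, ¬ G.Adj x y
  antiBD : ∀ x ∈ B, ∀ y ∈ D, ¬ G.Adj x y
  antiBE : ∀ x ∈ B, ∀ y ∈ E, ¬ G.Adj x y
  antiCE : ∀ x ∈ C, ∀ y ∈ E, ¬ G.Adj x y

namespace Blow

variable {V : Type*} {G : SimpleGraph V} {A B C D E : Finset V}

lemma reflect (Q : Blow G A B C D E) : Blow G B A E D C where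
  gem := Q.gem
  pp := Q.pp
  cardA := Q.cardB
  cardB := Q.cardA
  neC := Q.neE
  neD := Q.neD
  neE := Q.neC
  cliqueA := Q.cliqueB
  cliqueB := Q.cliqueA
  cliqueC := Q.cliqueE
  cliqueD := Q.cliqueD
  cliqueE := Q.cliqueC
  adjAB x hx y hy := (Q.adjAB y hy x hx).symm
  adjBC x hx y hy := (Q.adjEA y hy x hx).symm
  adjCD x hx y hy := (Q.adjDE y hy x hx).symm
  adjDE x hx y hy := (Q.adjCD y hy x hx).symm
  adjEA x hx y hy := (Q.adjBC y hy x hx).symm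
  antiAC := Q.antiBE
  antiAD := Q.antiBD
  antiBD := Q.antiAD
  antiBE := Q.antiAC
  antiCE x hx y hy h := Q.antiCE y hy x hx h.symm

/-! The adjacencies between the five cliques, in the form used by `grind`. -/

@[grind →] lemma sAB (Q : Blow G A B C D E) {x y : V} (hx : x ∈ A) (hy : y ∈ B) :
    G.Adj x y ∧ G.Adj y x := ⟨Q.adjAB x hx y hy, (Q.adjAB x hx y hy).symm⟩

@[grind →] lemma sBC (Q : Blow G A B C D E) {x y : V} (hx : x ∈ B) (hy : y ∈ C) :
    G.Adj x y ∧ G.Adj y x := ⟨Q.adjBC x hx y hy, (Q.adjBC x hx y hy).symm⟩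

@[grind →] lemma sCD (Q : Blow G A B C D E) {x y : V} (hx : x ∈ C) (hy : y ∈ D) :
    G.Adj x y ∧ G.Adj y x := ⟨Q.adjCD x hx y hy, (Q.adjCD x hx y hy).symm⟩

@[grind →] lemma sDE (Q : Blow G A B C D E) {x y : V} (hx : x ∈ D) (hy : y ∈ E) :
    G.Adj x y ∧ G.Adj y x := ⟨Q.adjDE x hx y hy, (Q.adjDE x hx y hy).symm⟩

@[grind →] lemma sEA (Q : Blow G A B C D E) {x y : V} (hx : x ∈ E) (hy : y ∈ A) :
    G.Adj x y ∧ G.Adj y x := ⟨Q.adjEA x hx y hy, (Q.adjEA x hx y hy).symm⟩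

@[grind →] lemma sAC (Q : Blow G A B C D E) {x y : V} (hx : x ∈ A) (hy : y ∈ C) :
    ¬ G.Adj x y ∧ ¬ G.Adj y x ∧ x ≠ y := by
  refine ⟨Q.antiAC x hx y hy, fun h => Q.antiAC x hx y hy h.symm, ?_⟩
  rintro rfl
  exact Q.antiAD x hx _ Q.neD.choose_spec (Q.adjCD x hy _ Q.neD.choose_spec)

@[grind →] lemma sAD (Q : Blow G A B C D E) {x y : V} (hx : x ∈ A) (hy : y ∈ D) :
    ¬ G.Adj x y ∧ ¬ G.Adj y x ∧ x ≠ y := by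
  refine ⟨Q.antiAD x hx y hy, fun h => Q.antiAD x hx y hy h.symm, ?_⟩
  rintro rfl
  exact Q.antiAC x hx _ Q.neC.choose_spec (Q.adjCD _ Q.neC.choose_spec x hy).symm

@[grind →] lemma sBD (Q : Blow G A B C D E) {x y : V} (hx : x ∈ B) (hy : y ∈ D) :
    ¬ G.Adj x y ∧ ¬ G.Adj y x ∧ x ≠ y := by
  refine ⟨Q.antiBD x hx y hy, fun h => Q.antiBD x hx y hy h.symm, ?_⟩
  rintro rfl
  exact Q.antiBE x hx _ Q.neE.choose_spec (Q.adjDE x hy _ Q.neE.choose_spec)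

@[grind →] lemma sBE (Q : Blow G A B C D E) {x y : V} (hx : x ∈ B) (hy : y ∈ E) :
    ¬ G.Adj x y ∧ ¬ G.Adj y x ∧ x ≠ y := by
  refine ⟨Q.antiBE x hx y hy, fun h => Q.antiBE x hx y hy h.symm, ?_⟩
  rintro rfl
  exact Q.antiBD x hx _ Q.neD.choose_spec (Q.adjDE _ Q.neD.choose_spec x hy).symm

@[grind →] lemma sCE (Q : Blow G A B C D E) {x y : V} (hx : x ∈ C) (hy : y ∈ E) :
    ¬ G.Adj x y ∧ ¬ G.Adj y x ∧ x ≠ y := by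
  refine ⟨Q.antiCE x hx y hy, fun h => Q.antiCE x hx y hy h.symm, ?_⟩
  rintro rfl
  obtain ⟨a, ha, -⟩ := one_lt_card.1 Q.cardA
  exact Q.antiAC a ha x hx (Q.adjEA x hy a ha).symm

@[grind →] lemma sA (Q : Blow G A B C D E) {x y : V} (hx : x ∈ A) (hy : y ∈ A) :
    x = y ∨ G.Adj x y := or_iff_not_imp_left.2 (Q.cliqueA x hx y hy)

@[grind →] lemma sB (Q : Blow G A B C D E) {x y : V} (hx : x ∈ B) (hy : y ∈ B) :
    x = y ∨ G.Adj x y := or_iff_not_imp_left.2 (Q.cliqueB x hx y hy)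

@[grind →] lemma sC (Q : Blow G A B C D E) {x y : V} (hx : x ∈ C) (hy : y ∈ C) :
    x = y ∨ G.Adj x y := or_iff_not_imp_left.2 (Q.cliqueC x hx y hy)

@[grind →] lemma sD (Q : Blow G A B C D E) {x y : V} (hx : x ∈ D) (hy : y ∈ D) :
    x = y ∨ G.Adj x y := or_iff_not_imp_left.2 (Q.cliqueD x hx y hy)

@[grind →] lemma sE (Q : Blow G A B C D E) {x y : V} (hx : x ∈ E) (hy : y ∈ E) :
    x = y ∨ G.Adj x y := or_iff_not_imp_left.2 (Q.cliqueE x hx y hy)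

lemma pairA (Q : Blow G A B C D E) : ∃ x ∈ A, ∃ y ∈ A, x ≠ y := one_lt_card.1 Q.cardA

lemma pairB (Q : Blow G A B C D E) : ∃ x ∈ B, ∃ y ∈ B, x ≠ y := one_lt_card.1 Q.cardB

lemma otherA (Q : Blow G A B C D E) (x : V) : ∃ y ∈ A, y ≠ x := exists_mem_ne Q.cardA x

lemma otherB (Q : Blow G A B C D E) (x : V) : ∃ y ∈ B, y ≠ x := exists_mem_ne Q.cardB x

variable {a b c d e u : V}

/-- The common non-neighbours of `d ∈ D` and `e ∈ E` induce a `P3`-free graph. -/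
lemma trans_de (Q : Blow G A B C D E) (hd : d ∈ D) (he : e ∈ E) {x y z : V}
    (hxy : G.Adj x y) (hyz : G.Adj y z) (hxz : x ≠ z) (hdx : ¬ G.Adj x d) (hdy : ¬ G.Adj y d)
    (hdz : ¬ G.Adj z d) (hex : ¬ G.Adj x e) (hey : ¬ G.Adj y e) (hez : ¬ G.Adj z e) :
    G.Adj x z := by
  by_contra h
  have := Q.pp d e x y z
  grind [G.adj_comm]

lemma adjC_of_adjD_of_not (Q : Blow G A B C D E) (hd : d ∈ D) (ha : a ∈ A) (hc : c ∈ C)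
    (huC : u ∉ C) (huE : u ∉ E) (hud : G.Adj u d) (hua : ¬ G.Adj u a) : G.Adj u c := by
  by_contra huc
  obtain ⟨e, he⟩ := Q.neE
  obtain ⟨a', ha', haa⟩ := Q.otherA a
  have h1 : G.Adj u a' := by
    by_contra h
    have := Q.pp a a' u d c
    grind [G.adj_comm]
  have h2 : ¬ G.Adj u e := by
    intro h
    have := Q.gem e a a' u d
    grind [G.adj_comm]
  have h3 : ∃ b ∈ B, G.Adj u b := by
    by_contra! h
    obtain ⟨b, hb, b', hb', hbb⟩ := Q.pairB
    have := Q.pp b b' u d e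
    grind [G.adj_comm]
  obtain ⟨b, hb, h3⟩ := h3
  have := Q.gem a' u b a e
  grind [G.adj_comm]

lemma not_adjC_of_adjD_of_adjA (Q : Blow G A B C D E) (hd : d ∈ D) (ha : a ∈ A) (hc : c ∈ C)
    (huE : u ∉ E) (hud : G.Adj u d) (hua : G.Adj u a) : ¬ G.Adj u c := by
  intro huc
  obtain ⟨e, he⟩ := Q.neE
  have h1 : ∀ b ∈ B, ¬ G.Adj u b := by
    intro b hb h
    have := Q.gem u a b c d
    grind [G.adj_comm]
  have h2 : ¬ G.Adj u e := by
    intro h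
    have := Q.gem u c d e a
    grind [G.adj_comm]
  obtain ⟨b, hb, b', hb', hbb⟩ := Q.pairB
  have := Q.pp b b' u d e
  grind [G.adj_comm]

/-- A vertex with no neighbour in the blowup. -/
def IsT (G : SimpleGraph V) (A B C D E : Finset V) (u : V) : Prop :=
  (∀ x ∈ A, ¬ G.Adj u x) ∧ (∀ x ∈ B, ¬ G.Adj u x) ∧ (∀ x ∈ C, ¬ G.Adj u x) ∧
    (∀ x ∈ D, ¬ G.Adj u x) ∧ ∀ x ∈ E, ¬ G.Adj u x

/-- A vertex with a neighbour in `A` and no neighbour in `B`, `D` and `E`. -/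
def IsU (G : SimpleGraph V) (A B D E : Finset V) (u : V) : Prop :=
  (∃ x ∈ A, G.Adj u x) ∧ (∀ x ∈ B, ¬ G.Adj u x) ∧ (∀ x ∈ D, ¬ G.Adj u x) ∧
    ∀ x ∈ E, ¬ G.Adj u x

/-- A vertex complete to `A` and `B` and anticomplete to `C` and `E`. -/
def IsW (G : SimpleGraph V) (A B C E : Finset V) (u : V) : Prop :=
  (∀ x ∈ A, G.Adj u x) ∧ (∀ x ∈ B, G.Adj u x) ∧ (∀ x ∈ C, ¬ G.Adj u x) ∧
    ∀ x ∈ E, ¬ G.Adj u x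

/-- A vertex that can be added to the clique `A`, whose neighbouring cliques are `B` and `E`. -/
def IsTwin (G : SimpleGraph V) (A B C D E : Finset V) (u : V) : Prop :=
  (∀ x ∈ A, G.Adj u x) ∧ (∀ x ∈ B, G.Adj u x) ∧ (∀ x ∈ C, ¬ G.Adj u x) ∧
    (∀ x ∈ D, ¬ G.Adj u x) ∧ ∀ x ∈ E, G.Adj u x

/-- `u` is a twin of one of the cliques. -/
def IsSomeTwin (G : SimpleGraph V) (A B C D E : Finset V) (u : V) : Prop :=
  IsTwin G A B C D E u ∨ IsTwin G B C D E A u ∨ IsTwin G C D E A B u ∨ IsTwin G D E A B C u ∨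
    IsTwin G E A B C D u

lemma IsSomeTwin.reflect (h : IsSomeTwin G B A E D C u) : IsSomeTwin G A B C D E u := by
  unfold IsSomeTwin IsTwin at *
  tauto

/-- The possible attachments of a vertex outside of the blowup. -/
def IsKnown (G : SimpleGraph V) (A B C D E : Finset V) (u : V) : Prop :=
  IsT G A B C D E u ∨ IsU G A B D E u ∨ IsU G B A D C u ∨ IsW G A B C E u ∨
    IsSomeTwin G A B C D E u

lemma IsKnown.reflect (h : IsKnown G B A E D C u) : IsKnown G A B C D E u := by
  rcases h with h | h | h | h | h
  · exact Or.inl (by unfold IsT at *; tauto)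
  · exact Or.inr (Or.inr (Or.inl h))
  · exact Or.inr (Or.inl h)
  · exact Or.inr (Or.inr (Or.inr (Or.inl (by unfold IsW at *; tauto))))
  · exact Or.inr (Or.inr (Or.inr (Or.inr h.reflect)))

lemma isKnown_of_adjD (Q : Blow G A B C D E) (huC : u ∉ C) (huD : u ∉ D) (huE : u ∉ E)
    (hd : d ∈ D) (hud : G.Adj u d) : IsKnown G A B C D E u := by
  obtain ⟨a, ha, a', ha', haa⟩ := Q.pairA
  obtain ⟨b, hb, b', hb', hbb⟩ := Q.pairB
  obtain ⟨c, hc⟩ := Q.neC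
  obtain ⟨e, he⟩ := Q.neE
  have h1 : ∀ x ∈ A, ∀ y ∈ C, G.Adj u x ↔ ¬ G.Adj u y := fun x hx y hy =>
    ⟨Q.not_adjC_of_adjD_of_adjA hd hx hy huE hud, fun h => by
      by_contra h'; exact h (Q.adjC_of_adjD_of_not hd hx hy huC huE hud h')⟩
  have h2 : ∀ x ∈ B, ∀ y ∈ E, G.Adj u x ↔ ¬ G.Adj u y := fun x hx y hy =>
    ⟨Q.reflect.not_adjC_of_adjD_of_adjA hd hx hy huC hud, fun h => by
      by_contra h'; exact h (Q.reflect.adjC_of_adjD_of_not hd hx hy huE huC hud h')⟩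
  by_cases hua : G.Adj u a <;> by_cases hub : G.Adj u b
  · have : IsW G A B C E u := ⟨by grind, by grind, by grind, by grind⟩
    simp [IsKnown, this]
  · have h3 : ∀ x ∈ D, G.Adj u x := by
      intro x hx
      by_contra h
      have := Q.gem e a u d x
      grind [G.adj_comm]
    have : IsTwin G E A B C D u := ⟨by grind, by grind, by grind, by grind, h3⟩
    simp [IsKnown, IsSomeTwin, this]
  · have h3 : ∀ x ∈ D, G.Adj u x := by
      intro x hx
      by_contra h
      have := Q.gem c b u d x
      grind [G.adj_comm]
    have : IsTwin G C D E A B u := ⟨by grind, h3, by grind, by grind, by grind⟩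
    simp [IsKnown, IsSomeTwin, this]
  · have h3 : ∀ x ∈ D, G.Adj u x := by
      intro x hx
      by_contra h
      have := Q.pp b b' u e x
      grind [G.adj_comm]
    have : IsTwin G D E A B C u := ⟨h3, by grind, by grind, by grind, by grind⟩
    simp [IsKnown, IsSomeTwin, this]

lemma isKnown_of_adjC (Q : Blow G A B C D E) (huB : u ∉ B) (huD : u ∉ D)
    (hD : ∀ x ∈ D, ¬ G.Adj u x) (hc : c ∈ C) (huc : G.Adj u c) :
    IsKnown G A B C D E u := by
  obtain ⟨a, ha, a', ha', haa⟩ := Q.pairA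
  obtain ⟨d, hd⟩ := Q.neD
  obtain ⟨e, he⟩ := Q.neE
  by_cases hB : ∃ b ∈ B, G.Adj u b
  · obtain ⟨b, hb, hub⟩ := hB
    have hA : ∀ x ∈ A, G.Adj u x := by
      intro x hx
      by_contra h
      obtain ⟨y, hy, hyx⟩ := Q.otherA x
      by_cases huy : G.Adj u y
      · have := Q.gem b x y u c
        grind [G.adj_comm]
      · have := Q.pp x y u c d
        grind [G.adj_comm]
    have hE : ∀ x ∈ E, ¬ G.Adj u x := by
      intro x hx h
      have := Q.gem u x a b c
      grind [G.adj_comm]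
    have hB : ∀ x ∈ B, G.Adj u x := by
      intro x hx
      have := Q.trans_de hd he (x := u) (y := b) (z := x)
      grind [G.adj_comm]
    have hC : ∀ x ∈ C, G.Adj u x := by
      intro x hx
      by_contra h
      have := Q.gem b a u c x
      grind [G.adj_comm]
    have : IsTwin G B C D E A u := ⟨hB, hC, hD, hE, hA⟩
    simp [IsKnown, IsSomeTwin, this]
  · push Not at hB
    have hE : ∀ x ∈ E, ¬ G.Adj u x := by
      intro x hx h
      obtain ⟨b, hb, b', hb', hbb⟩ := Q.pairB
      have := Q.pp b b' u x d
      grind [G.adj_comm]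
    have hA : ∃ x ∈ A, G.Adj u x := by
      by_contra! h
      have := Q.pp a a' u c d
      grind [G.adj_comm]
    have : IsU G A B D E u := ⟨hA, hB, hD, hE⟩
    simp [IsKnown, this]

lemma adjA_of_adjA (Q : Blow G A B C D E) (huA : u ∉ A)
    (hC : ∀ x ∈ C, ¬ G.Adj u x) (hD : ∀ x ∈ D, ¬ G.Adj u x)
    (ha : a ∈ A) (hua : G.Adj u a) {x : V} (hx : x ∈ A) : G.Adj u x := by
  obtain ⟨c, hc⟩ := Q.neC
  obtain ⟨d, hd⟩ := Q.neD
  by_contra h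
  have := Q.pp c d u a x
  grind [G.adj_comm]

lemma isKnown (Q : Blow G A B C D E) (huA : u ∉ A) (huB : u ∉ B) (huC : u ∉ C) (huD : u ∉ D)
    (huE : u ∉ E) : IsKnown G A B C D E u := by
  by_cases hD : ∃ d ∈ D, G.Adj u d
  · obtain ⟨d, hd, hud⟩ := hD
    exact Q.isKnown_of_adjD huC huD huE hd hud
  push Not at hD
  by_cases hC : ∃ c ∈ C, G.Adj u c
  · obtain ⟨c, hc, huc⟩ := hC
    exact Q.isKnown_of_adjC huB huD hD hc huc
  by_cases hE : ∃ e ∈ E, G.Adj u e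
  · obtain ⟨e, he, hue⟩ := hE
    exact (Q.reflect.isKnown_of_adjC huA huD hD he hue).reflect
  push Not at hC hE
  have hA := fun a ha => Q.adjA_of_adjA huA hC hD (a := a) ha
  have hB := fun b hb => Q.reflect.adjA_of_adjA huB hE hD (a := b) hb
  unfold IsKnown IsT IsU IsW
  by_cases hA' : ∃ a ∈ A, G.Adj u a <;> by_cases hB' : ∃ b ∈ B, G.Adj u b <;> grind

end Blow

/-- Every vertex outside of the blowup has one of four kinds of attachments. -/
def Covers {V : Type*} (G : SimpleGraph V) (A B C D E : Finset V) : Prop :=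
  ∀ u, u ∈ A ∨ u ∈ B ∨ u ∈ C ∨ u ∈ D ∨ u ∈ E ∨ Blow.IsT G A B C D E u ∨
    Blow.IsU G A B D E u ∨ Blow.IsU G B A D C u ∨ Blow.IsW G A B C E u

namespace Blow

variable {V : Type*} {G : SimpleGraph V} {A B C D E : Finset V} {a b c d e u : V}

section Insert

variable [DecidableEq V]

lemma insertA (Q : Blow G A B C D E) (h : IsTwin G A B C D E u) : Blow G (insert u A) B C D E := by
  obtain ⟨hA, hB, hC, hD, hE⟩ := h
  constructor
  · exact Q.gem
  · exact Q.pp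
  · exact Q.cardA.trans_le (card_le_card (subset_insert _ _))
  · exact Q.cardB
  · exact Q.neC
  · exact Q.neD
  · exact Q.neE
  all_goals grind [G.adj_comm]

lemma insertC (Q : Blow G A B C D E) (h : IsTwin G C D E A B u) : Blow G A B (insert u C) D E := by
  obtain ⟨hC, hD, hE, hA, hB⟩ := h
  constructor
  · exact Q.gem
  · exact Q.pp
  · exact Q.cardA
  · exact Q.cardB
  · exact insert_nonempty _ _
  · exact Q.neD
  · exact Q.neE
  all_goals grind [G.adj_comm]

lemma insertD (Q : Blow G A B C D E) (h : IsTwin G D E A B C u) : Blow G A B C (insert u D) E := by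
  obtain ⟨hD, hE, hA, hB, hC⟩ := h
  constructor
  · exact Q.gem
  · exact Q.pp
  · exact Q.cardA
  · exact Q.cardB
  · exact Q.neC
  · exact insert_nonempty _ _
  · exact Q.neE
  all_goals grind [G.adj_comm]

lemma exists_larger (Q : Blow G A B C D E) (huA : u ∉ A) (huB : u ∉ B) (huC : u ∉ C)
    (huD : u ∉ D) (huE : u ∉ E) (h : IsSomeTwin G A B C D E u) :
    ∃ A' B' C' D' E', Blow G A' B' C' D' E' ∧
      #A + #B + #C + #D + #E < #A' + #B' + #C' + #D' + #E' := by
  rcases h with h | h | h | h | h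
  · exact ⟨_, _, _, _, _, Q.insertA h, by rw [card_insert_of_notMem huA]; omega⟩
  · refine ⟨_, _, _, _, _, (Q.reflect.insertA (u := u) ?_).reflect,
      by rw [card_insert_of_notMem huB]; omega⟩
    unfold IsTwin at *; tauto
  · exact ⟨_, _, _, _, _, Q.insertC h, by rw [card_insert_of_notMem huC]; omega⟩
  · exact ⟨_, _, _, _, _, Q.insertD h, by rw [card_insert_of_notMem huD]; omega⟩
  · refine ⟨_, _, _, _, _, (Q.reflect.insertC (u := u) ?_).reflect,
      by rw [card_insert_of_notMem huE]; omega⟩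
    unfold IsTwin at *; tauto

end Insert

lemma exists_covers [Fintype V] (Q : Blow G A B C D E) :
    ∃ A B C D E, Blow G A B C D E ∧ Covers G A B C D E := by
  classical
  induction h : 5 * Fintype.card V - (#A + #B + #C + #D + #E) using Nat.strong_induction_on
    generalizing A B C D E with
  | _ n ih =>
    by_cases hc : Covers G A B C D E
    · exact ⟨A, B, C, D, E, Q, hc⟩
    · unfold Covers at hc
      push Not at hc
      obtain ⟨u, huA, huB, huC, huD, huE, h1, h2, h3, h4⟩ := hc
      have hu : IsSomeTwin G A B C D E u := by
        simpa [IsKnown, h1, h2, h3, h4] using Q.isKnown huA huB huC huD huE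
      obtain ⟨A', B', C', D', E', Q', hlt⟩ := Q.exists_larger huA huB huC huD huE hu
      refine ih _ ?_ Q' rfl
      have := card_le_univ A'
      have := card_le_univ B'
      have := card_le_univ C'
      have := card_le_univ D'
      have := card_le_univ E'
      omega

lemma of_F1' (hg : NoGem G) (hp : NoP2P3 G) (h : Nonempty (graphF1' ↪g G)) :
    ∃ A B C D E, Blow G A B C D E := by
  classical
  obtain ⟨f⟩ := h
  obtain ⟨f, hf', hf⟩ : ∃ g : Fin 7 → V, Function.Injective g ∧
      ∀ i j, G.Adj (g i) (g j) ↔ graphF1'.Adj i j := ⟨f, f.injective, fun i j => f.map_adj_iff⟩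
  refine ⟨{f 0, f 5}, {f 1, f 6}, {f 2}, {f 3}, {f 4}, ?_⟩
  constructor
  · exact hg
  · exact hp
  · rw [card_pair (by simp [hf'.eq_iff])]; simp
  · rw [card_pair (by simp [hf'.eq_iff])]; simp
  · simp
  · simp
  · simp
  all_goals simp [hf, hf'.eq_iff, graphF1']

lemma _root_.GemFree.Covers.reflect (h : Covers G A B C D E) : Covers G B A E D C := by
  intro u
  have := h u
  unfold IsT IsW at *
  tauto

end Blow

lemma inClassC_of_partition {V : Type*} {G : SimpleGraph V} (q : Fin 5 → Finset V) (T : Finset V)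
    (hne : ∀ i, (q i).Nonempty) (hcov : ∀ x, (∃ i, x ∈ q i) ∨ x ∈ T)
    (hdisj : ∀ i j x, x ∈ q i → x ∈ q j → i = j)
    (hadj : ∀ i j x y, x ∈ q i → y ∈ q j → x ≠ y → (G.Adj x y ↔ i = j ∨ j = i + 1 ∨ i = j + 1))
    (hqT : ∀ i, ∀ x ∈ q i, x ∉ T) (hT : ∀ x ∈ T, ∀ y, ¬ G.Adj x y) : InClassC G := by
  refine ⟨fun i => #(q i), #T, fun i => card_pos.2 (hne i), ⟨RelIso.symm ?_⟩⟩
  let φ : (Σ i : Fin 5, Fin #(q i)) ⊕ Fin #T → V :=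
    Sum.elim (fun p => ((q p.1).equivFin.symm p.2 : V)) fun k => (T.equivFin.symm k : V)
  have hq : ∀ p, φ (Sum.inl p) ∈ q p.1 := fun p => ((q p.1).equivFin.symm p.2).2
  have hφT : ∀ k, φ (Sum.inr k) ∈ T := fun k => (T.equivFin.symm k).2
  have hinj : Function.Injective φ := by
    rintro (p | k) (p' | k') h
    · obtain ⟨i, m⟩ := p
      obtain ⟨j, m'⟩ := p'
      have hm := hq ⟨i, m⟩
      rw [h] at hm
      obtain rfl : i = j := hdisj _ _ _ hm (hq ⟨j, m'⟩)
      have : m = m' := (q i).equivFin.symm.injective (Subtype.ext h)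
      rw [this]
    · exact (hqT _ _ (hq p) (h ▸ hφT k')).elim
    · exact (hqT _ _ (hq p') (h ▸ hφT k)).elim
    · have : k = k' := T.equivFin.symm.injective (Subtype.ext h)
      rw [this]
  have hsurj : Function.Surjective φ := by
    intro x
    rcases hcov x with ⟨i, hi⟩ | hx
    · exact ⟨Sum.inl ⟨i, (q i).equivFin ⟨x, hi⟩⟩, by simp [φ]⟩
    · exact ⟨Sum.inr (T.equivFin ⟨x, hx⟩), by simp [φ]⟩
  have hbij : Function.Bijective φ := ⟨hinj, hsurj⟩
  suffices h : ∀ x y, G.Adj (φ x) (φ y) ↔ (blowupC5 (fun i => #(q i)) #T).Adj x y from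
    ⟨Equiv.ofBijective φ hbij, h _ _⟩
  rintro (p | k) (p' | k')
  · by_cases h : p = p'
    · simp [h]
    · rw [hadj _ _ _ _ (hq p) (hq p') (by simpa [hinj.eq_iff] using h)]
      simp only [blowupC5, fromRel_adj, ne_eq, Sum.inl.injEq, h, not_false_eq_true, true_and]
      constructor
      · rintro (h | h | h)
        exacts [Or.inl ⟨_, _, rfl, rfl, Or.inl h⟩, Or.inl ⟨_, _, rfl, rfl, Or.inr h⟩,
          Or.inr ⟨_, _, rfl, rfl, Or.inr h⟩]
      · rintro (⟨_, _, rfl, rfl, h | h⟩ | ⟨_, _, rfl, rfl, h | h⟩) <;> simp [h]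
  · simp only [blowupC5, fromRel_adj]
    simpa using fun h => hT _ (hφT k') _ h.symm
  · simpa [blowupC5] using fun h => hT _ (hφT k) _ h
  · simpa [blowupC5] using fun h => hT _ (hφT k) _ h

namespace Blow

variable {V : Type*} {G : SimpleGraph V} {A B C D E : Finset V} {x y : V}

/-- Vertices without neighbours in `C`, `D` and `E` are pairwise nonadjacent. -/
lemma not_adj_of_anti (Q : Blow G A B C D E)
    (hxC : ∀ c ∈ C, ¬ G.Adj x c) (hxD : ∀ d ∈ D, ¬ G.Adj x d) (hxE : ∀ e ∈ E, ¬ G.Adj x e)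
    (hyC : ∀ c ∈ C, ¬ G.Adj y c) (hyD : ∀ d ∈ D, ¬ G.Adj y d) (hyE : ∀ e ∈ E, ¬ G.Adj y e) :
    ¬ G.Adj x y := by
  intro h
  obtain ⟨c, hc⟩ := Q.neC
  obtain ⟨d, hd⟩ := Q.neD
  obtain ⟨e, he⟩ := Q.neE
  have := Q.pp x y c d e
  grind [G.adj_comm]

lemma not_adj_of_isT (Q : Blow G A B C D E) (h : IsT G A B C D E x) (h' : IsT G A B C D E y) :
    ¬ G.Adj x y := by
  unfold IsT at h h'
  exact Q.not_adj_of_anti h.2.2.1 h.2.2.2.1 h.2.2.2.2 h'.2.2.1 h'.2.2.2.1 h'.2.2.2.2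

lemma inClassC [Fintype V] (Q : Blow G A B C D E) (hcov : Covers G A B C D E)
    (hU : ∀ u, ¬ IsU G A B D E u) (hU' : ∀ u, ¬ IsU G B A D C u) (hW : ∀ u, ¬ IsW G A B C E u) :
    InClassC G := by
  classical
  obtain ⟨a, ha, -⟩ := Q.pairA
  obtain ⟨b, hb, -⟩ := Q.pairB
  obtain ⟨c, hc⟩ := Q.neC
  obtain ⟨d, hd⟩ := Q.neD
  obtain ⟨e, he⟩ := Q.neE
  refine inClassC_of_partition ![A, B, C, D, E] (univ.filter (IsT G A B C D E)) ?_ ?_ ?_ ?_ ?_ ?_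
  · intro i
    fin_cases i
    exacts [⟨a, ha⟩, ⟨b, hb⟩, ⟨c, hc⟩, ⟨d, hd⟩, ⟨e, he⟩]
  · intro x
    have := hcov x
    simp only [hU, hU', hW, or_false] at this
    simp [Fin.exists_fin_succ]
    tauto
  · intro i j x hi hj
    fin_cases i <;> fin_cases j <;> simp at hi hj ⊢ <;> grind [G.adj_comm]
  · intro i j x y hi hj hxy
    fin_cases i <;> fin_cases j <;> simp at hi hj ⊢ <;> grind [G.adj_comm]
  · intro i x hi
    unfold IsT
    fin_cases i <;> simp at hi ⊢ <;> grind [G.adj_comm]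
  · intro x hx y hxy
    have hx := (mem_filter.1 hx).2
    have hy := hcov y
    simp only [hU, hU', hW, or_false] at hy
    have := Q.not_adj_of_isT hx (y := y)
    unfold IsT at *
    grind

end Blow

section Clique

variable {V : Type*} {G : SimpleGraph V} {K L S : Finset V}

lemma card_le_cliqueNum [Fintype V] (h : ∀ x ∈ S, ∀ y ∈ S, x ≠ y → G.Adj x y) :
    #S ≤ G.cliqueNum :=
  IsClique.card_le_cliqueNum (tc := fun x hx y hy => h x hx y hy)

lemma card_add_card_le_cliqueNum [Fintype V] (hK : ∀ x ∈ K, ∀ y ∈ K, x ≠ y → G.Adj x y)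
    (hL : ∀ x ∈ L, ∀ y ∈ L, x ≠ y → G.Adj x y) (h : ∀ x ∈ K, ∀ y ∈ L, G.Adj x y) :
    #K + #L ≤ G.cliqueNum := by
  classical
  have hd : Disjoint K L := disjoint_left.2 fun x hx hy => G.irrefl (h x hx x hy)
  rw [← card_union_of_disjoint hd]
  refine card_le_cliqueNum fun x hx y hy hxy => ?_
  grind [G.adj_comm]

lemma card_add_card_add_card_le_cliqueNum [Fintype V]
    (hK : ∀ x ∈ K, ∀ y ∈ K, x ≠ y → G.Adj x y) (hL : ∀ x ∈ L, ∀ y ∈ L, x ≠ y → G.Adj x y)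
    (hS : ∀ x ∈ S, ∀ y ∈ S, x ≠ y → G.Adj x y) (hKL : ∀ x ∈ K, ∀ y ∈ L, G.Adj x y)
    (hKS : ∀ x ∈ K, ∀ y ∈ S, G.Adj x y) (hLS : ∀ x ∈ L, ∀ y ∈ S, G.Adj x y) :
    #K + #L + #S ≤ G.cliqueNum := by
  classical
  have hd : Disjoint K L := disjoint_left.2 fun x hx hy => G.irrefl (hKL x hx x hy)
  rw [← card_union_of_disjoint hd]
  refine card_add_card_le_cliqueNum (fun x hx y hy hxy => ?_) hS fun x hx y hy => ?_
  · grind [G.adj_comm]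
  · grind

/-- In a gem-free situation, two cliques with few non-edges between them are small. -/
lemma card_add_card_le_cliqueNum_succ [Fintype V] (hK : ∀ x ∈ K, ∀ y ∈ K, x ≠ y → G.Adj x y)
    (hL : ∀ x ∈ L, ∀ y ∈ L, x ≠ y → G.Adj x y) (h3 : 3 ≤ #K)
    (hmiss : ∀ u ∈ L, ∀ x ∈ K, ∀ y ∈ K, x ≠ y → ¬ G.Adj u x → G.Adj u y)
    (hgem : ∀ x ∈ K, ∀ y ∈ K, x ≠ y → ∀ u ∈ L, ∀ v ∈ L, u ≠ v → G.Adj u x → G.Adj u y →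
      G.Adj v y → ¬ G.Adj v x → False) :
    #K + #L ≤ G.cliqueNum + 1 := by
  classical
  by_cases hall : ∀ x ∈ K, ∀ u ∈ L, G.Adj x u
  · have := card_add_card_le_cliqueNum hK hL hall
    omega
  · push Not at hall
    obtain ⟨w, hw, v, hv, hwv⟩ := hall
    have hcomp : ∀ x ∈ K.erase w, ∀ u ∈ L, G.Adj x u := by
      intro x hx u hu
      by_cases huw : G.Adj u w
      · have hc : 2 ≤ #(K.erase w) := by
          rw [card_erase_of_mem hw]; omega
        obtain ⟨x, hx, y, hy, hxy⟩ := one_lt_card.1 hc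
        have h1 := hgem w hw x (by grind) (by grind) u hu v hv
        have h2 := hgem w hw y (by grind) (by grind) u hu v hv
        have h3 := hmiss u hu x (by grind) y (by grind) hxy
        have h4 := hmiss v hv w hw x (by grind) (by grind)
        have h5 := hmiss v hv w hw y (by grind) (by grind)
        grind [G.adj_comm]
      · exact (hmiss u hu w hw x (by grind) (by grind) huw).symm
    have := card_add_card_le_cliqueNum (G := G) (K := K.erase w) (by grind) hL hcomp
    rw [card_erase_of_mem hw] at this
    omega

lemma exists_clique_colorableOn (hP : ∀ a ∈ S, ∀ b ∈ S, ∀ c ∈ S, ∀ d ∈ S, G.Adj a b → G.Adj b c →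
    G.Adj c d → ¬ G.Adj a c → ¬ G.Adj a d → ¬ G.Adj b d → False) :
    ∃ K ⊆ S, (∀ x ∈ K, ∀ y ∈ K, x ≠ y → G.Adj x y) ∧ ColorableOn G S #K := by
  classical
  obtain ⟨K, hK, hmax⟩ := exists_max_image
    (S.powerset.filter fun M => ∀ u ∈ M, ∀ v ∈ M, u ≠ v → G.Adj u v) card ⟨∅, by simp⟩
  simp only [mem_filter, mem_powerset] at hK hmax
  exact ⟨K, hK.1, hK.2, colorableOn_of_noP4 hP fun L hLS hL => hmax L
    ⟨hLS, fun u hu v hv => hL hu hv⟩⟩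

lemma ColorableOn.pos (h : ColorableOn G S #K) (hS : S.Nonempty) : 0 < #K := by
  obtain ⟨f, hf, -⟩ := h
  obtain ⟨x, hx⟩ := hS
  exact (hf x hx).pos

end Clique

namespace Blow

variable {V : Type*} {G : SimpleGraph V} {A B C D E : Finset V} {w w' : V}

lemma eqE_of_isW (Q : Blow G A B C D E) (hw : IsW G A B C E w) {x y : V} (hx : x ∈ E)
    (hy : y ∈ E) : x = y := by
  by_contra hxy
  obtain ⟨a, ha, -⟩ := Q.pairA
  obtain ⟨b, hb, -⟩ := Q.pairB
  obtain ⟨c, hc⟩ := Q.neC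
  have := Q.pp x y w b c
  unfold IsW at hw
  grind [G.adj_comm]

lemma IsW.reflect (hw : IsW G A B C E w) : IsW G B A E C w := by
  unfold IsW at *; tauto

lemma noP4_of_isW (Q : Blow G A B C D E) (S : Finset V) (hS : ∀ w ∈ S, IsW G A B C E w) :
    ∀ a ∈ S, ∀ b ∈ S, ∀ c ∈ S, ∀ d ∈ S, G.Adj a b → G.Adj b c →
      G.Adj c d → ¬ G.Adj a c → ¬ G.Adj a d → ¬ G.Adj b d → False := by
  intro x hx y hy z hz t ht h1 h2 h3 h4 h5 h6
  obtain ⟨a, ha, -⟩ := Q.pairA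
  have h := fun w hw => (((hS w hw).1 a ha).symm)
  exact Q.gem a x y z t h1 h2 h3 (h x hx) (h y hy) (h z hz) (h t ht) h4 h5 h6

lemma card_add_cardD_le [Fintype V] (Q : Blow G A B C D E) {K : Finset V}
    (hKW : ∀ w ∈ K, IsW G A B C E w)
    (hK : ∀ x ∈ K, ∀ y ∈ K, x ≠ y → G.Adj x y) : #K + #D ≤ G.cliqueNum + 1 := by
  obtain ⟨a, ha, -⟩ := Q.pairA
  obtain ⟨c, hc⟩ := Q.neC
  obtain ⟨e, he⟩ := Q.neE
  by_cases h3 : 3 ≤ #K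
  · refine card_add_card_le_cliqueNum_succ hK Q.cliqueD h3 ?_ ?_
    · intro u hu x hx y hy hxy h
      by_contra h'
      have := hKW x hx
      have := hKW y hy
      have := Q.pp x y c u e
      unfold IsW at *
      grind [G.adj_comm]
    · intro x hx y hy hxy u hu v hv huv h1 h2 h3 h4
      have := hKW x hx
      have := hKW y hy
      have := Q.gem y a x u v
      unfold IsW at *
      grind [G.adj_comm]
  · have := card_add_card_le_cliqueNum Q.cliqueD Q.cliqueE Q.adjDE
    have := card_pos.2 Q.neE
    omega

lemma colorableOn_of_not_isU [Fintype V] (Q : Blow G A B C D E) (hcov : Covers G A B C D E)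
    (hU : ∀ u, ¬ IsU G A B D E u) (hU' : ∀ u, ¬ IsU G B A D C u) (hw : IsW G A B C E w) :
    ColorableOn G univ (G.cliqueNum + 1) := by
  classical
  obtain ⟨K, hKS, hK, hcol⟩ := exists_clique_colorableOn
    (Q.noP4_of_isW (univ.filter (IsW G A B C E)) fun w hw => (mem_filter.1 hw).2)
  have hKW : ∀ w ∈ K, IsW G A B C E w := fun w hw => (mem_filter.1 (hKS hw)).2
  have hpos : 1 ≤ #K := hcol.pos ⟨w, by simpa using hw⟩
  have h1 := Q.card_add_cardD_le hKW hK
  have h2 := card_add_card_add_card_le_cliqueNum hK Q.cliqueA Q.cliqueB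
    (fun w hw => (hKW w hw).1) (fun w hw => (hKW w hw).2.1) Q.adjAB
  have hCE : ColorableOn G (C ∪ E) 1 := colorableOn_one fun x hx y hy => by
    have hE := Q.eqE_of_isW hw (x := x) (y := y)
    have hC := Q.reflect.eqE_of_isW hw.reflect (x := x) (y := y)
    grind [G.irrefl]
  have hT : ColorableOn G (univ.filter (IsT G A B C D E)) 1 := colorableOn_one fun x hx y hy =>
    Q.not_adj_of_isT (mem_filter.1 hx).2 (mem_filter.1 hy).2
  have c1 := hcol.union_anti (hCE.mono subset_rfl hpos) (by
    intro u hu v hv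
    have := (mem_filter.1 hu).2
    unfold IsW at this
    grind)
  have hDpos : 1 ≤ #D := card_pos.2 Q.neD
  have c2 := ((colorableOn_card (G := G) D).mono subset_rfl (le_max_right (#A + #B) #D)).union_anti
    (hT.mono subset_rfl (hDpos.trans (le_max_right (#A + #B) #D))) (by
    intro u hu v hv
    have := (mem_filter.1 hv).2
    unfold IsT at this
    grind [G.adj_comm])
  have c3 := (((colorableOn_card (G := G) A).union (colorableOn_card B)).mono subset_rfl
    (le_max_left _ #D)).union_anti c2 (by
    intro u hu v hv huv
    have hv : v ∈ D ∨ IsT G A B C D E v := by grind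
    unfold IsT at hv
    grind [G.adj_comm])
  refine (c1.union c3).mono ?_ (by omega)
  intro u _
  have := hcov u
  simp only [hU, hU'] at this
  simp only [mem_union, mem_filter, mem_univ, true_and]
  tauto

variable {a b c d e u v x y z : V}

lemma not_mem_of_isU (Q : Blow G A B C D E) (h : IsU G A B D E u) :
    u ∉ A ∧ u ∉ B ∧ u ∉ C ∧ u ∉ D ∧ u ∉ E := by
  obtain ⟨d, hd⟩ := Q.neD
  obtain ⟨e, he⟩ := Q.neE
  obtain ⟨b, hb, hbu⟩ := Q.otherB u
  unfold IsU at h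
  refine ⟨?_, ?_, ?_, ?_, ?_⟩ <;> grind

lemma eqD_of_isU (Q : Blow G A B C D E) (hu : IsU G A B D E u) (hx : x ∈ D) (hy : y ∈ D) :
    x = y := by
  by_contra hxy
  have := Q.not_mem_of_isU hu
  obtain ⟨⟨a, ha, hua⟩, hB, hD, hE⟩ := hu
  obtain ⟨b, hb, -⟩ := Q.pairB
  have := Q.pp x y u a b
  grind [G.adj_comm]

lemma adjC_of_isU (Q : Blow G A B C D E) (hu : IsU G A B D E u) (ha : a ∈ A)
    (hua : ¬ G.Adj u a) (hc : c ∈ C) : G.Adj u c := by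
  by_contra huc
  have := Q.not_mem_of_isU hu
  obtain ⟨⟨a', ha', hua'⟩, hB, hD, hE⟩ := hu
  obtain ⟨d, hd⟩ := Q.neD
  have := Q.pp c d u a' a
  grind [G.adj_comm]

lemma adjA_of_isU_of_isW (Q : Blow G A B C D E) (hw : IsW G A B C E w) (hu : IsU G A B D E u)
    (ha : a ∈ A) : G.Adj u a := by
  by_contra hua
  have huC := fun c => Q.adjC_of_isU hu ha hua (c := c)
  have := Q.not_mem_of_isU hu
  obtain ⟨⟨a', ha', hua'⟩, hB, hD, hE⟩ := hu
  obtain ⟨c, hc⟩ := Q.neC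
  obtain ⟨e, he⟩ := Q.neE
  obtain ⟨b, hb, -⟩ := Q.pairB
  unfold IsW at hw
  by_cases huw : G.Adj u w
  · have := Q.gem a' u w a e
    grind [G.adj_comm]
  · have := Q.pp u c w a e
    grind [G.adj_comm]

/-- If `C` has two vertices, then a vertex attached to `B` has no neighbour in `E`. -/
lemma not_adjE_of_isU (Q : Blow G A B C D E) (hx : x ∈ C) (hy : y ∈ C) (hxy : x ≠ y)
    (hu : IsU G B A D C u) (he : e ∈ E) : ¬ G.Adj u e := by
  intro hue
  have := Q.reflect.not_mem_of_isU hu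
  obtain ⟨⟨b, hb, hub⟩, hA, hD, hC⟩ := hu
  obtain ⟨a, ha, -⟩ := Q.pairA
  have := Q.pp x y u e a
  grind [G.adj_comm]

lemma eqC_of_isU (Q : Blow G A B C D E) (hu : IsU G A B D E u) (hx : x ∈ C)
    (hy : y ∈ C) (hux : ¬ G.Adj u x) (huy : ¬ G.Adj u y) : x = y := by
  by_contra hxy
  have := Q.not_mem_of_isU hu
  obtain ⟨⟨a, ha, hua⟩, hB, hD, hE⟩ := hu
  obtain ⟨e, he⟩ := Q.neE
  have := Q.pp x y u a e
  grind [G.adj_comm]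

lemma cardC_le_or_cardE_le_of_isU (Q : Blow G A B C D E) (hu : IsU G A B D E u) :
    #C ≤ 1 ∨ #E ≤ 1 := by
  by_contra! h
  obtain ⟨x, hx, y, hy, hxy⟩ := one_lt_card.1 h.1
  obtain ⟨x', hx', y', hy', hxy'⟩ := one_lt_card.1 h.2
  have h1 := fun c => Q.reflect.not_adjE_of_isU hx' hy' hxy' hu (e := c)
  exact hxy (Q.eqC_of_isU hu hx hy (h1 x hx) (h1 y hy))

lemma adj_of_isU_of_isU (Q : Blow G A B C D E) (hx : IsU G A B D E x) (hy : IsU G A B D E y)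
    (hz : IsU G A B D E z) (hxy : G.Adj x y) (hyz : G.Adj y z) (hxz : x ≠ z) : G.Adj x z := by
  obtain ⟨d, hd⟩ := Q.neD
  obtain ⟨e, he⟩ := Q.neE
  unfold IsU at *
  exact Q.trans_de hd he hxy hyz hxz (by grind) (by grind) (by grind) (by grind) (by grind)
    (by grind)

lemma exists_clique_colorableOn_of_isU (Q : Blow G A B C D E) (S : Finset V)
    (hS : ∀ x ∈ S, IsU G A B D E x) :
    ∃ K ⊆ S, (∀ x ∈ K, ∀ y ∈ K, x ≠ y → G.Adj x y) ∧ ColorableOn G S #K := by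
  refine exists_clique_colorableOn ?_
  intro x hx y hy z hz t ht h1 h2 h3 h4 h5 h6
  have hxz : x ≠ z := by rintro rfl; exact h5 h3
  exact h4 (Q.adj_of_isU_of_isU (hS x hx) (hS y hy) (hS z hz) h1 h2 hxz)

/-- Two adjacent vertices attached to `A` have no common non-neighbour in `A`, and none in `C`. -/
lemma adj_or_adj_of_isU (Q : Blow G A B C D E) (hx : IsU G A B D E x) (hy : IsU G A B D E y)
    (hxy : G.Adj x y) (hz : z ∈ A ∨ z ∈ C) : G.Adj z x ∨ G.Adj z y := by
  by_contra! h
  obtain ⟨d, hd⟩ := Q.neD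
  obtain ⟨e, he⟩ := Q.neE
  unfold IsU at *
  rcases hz with hz | hz
  · have := Q.pp x y z e d
    grind [G.adj_comm]
  · have := Q.pp x y z d e
    grind [G.adj_comm]

lemma card_add_card_le_of_isU [Fintype V] (Q : Blow G A B C D E) {K L : Finset V}
    (hKU : ∀ x ∈ K, IsU G A B D E x) (hK : ∀ x ∈ K, ∀ y ∈ K, x ≠ y → G.Adj x y) (h3 : 3 ≤ #K)
    (hL : L = A ∨ L = C) : #K + #L ≤ G.cliqueNum + 1 := by
  obtain ⟨b, hb, -⟩ := Q.pairB
  have hLc : ∀ x ∈ L, ∀ y ∈ L, x ≠ y → G.Adj x y := by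
    rcases hL with rfl | rfl
    exacts [Q.cliqueA, Q.cliqueC]
  refine card_add_card_le_cliqueNum_succ hK hLc h3 ?_ ?_
  · intro u hu x hx y hy hxy h
    exact (Q.adj_or_adj_of_isU (hKU x hx) (hKU y hy) (hK x hx y hy hxy) (by grind)).resolve_left h
  · intro x hx y hy hxy u hu v hv huv h1 h2 h3 h4
    have hxU := hKU x hx
    have hyU := hKU y hy
    unfold IsU at *
    have := Q.gem u x y v b
    have hubv : G.Adj u b ∧ G.Adj v b := by grind
    grind [G.adj_comm]

end Blow

lemma exists_finset_mem_iff {V : Type*} [Fintype V] (p : V → Prop) :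
    ∃ S : Finset V, ∀ x, x ∈ S ↔ p x := by
  classical
  exact ⟨univ.filter p, by simp⟩

namespace Blow

variable {V : Type*} {G : SimpleGraph V} {A B C D E : Finset V} {a b c d e u v w x y z : V}

/-- An edge between vertices attached to `A` is dominated by each vertex of `W` with a neighbour
in `D`. -/
lemma adj_of_isW_of_isU (Q : Blow G A B C D E) (hz : IsW G A B C E z) (hd : d ∈ D)
    (hzd : G.Adj z d) (hx : IsU G A B D E x) (hy : IsU G A B D E y) (hxy : G.Adj x y) :
    G.Adj z x := by
  by_contra h
  have hxA := fun a => Q.adjA_of_isU_of_isW hz hx (a := a)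
  have hyA := fun a => Q.adjA_of_isU_of_isW hz hy (a := a)
  obtain ⟨a, ha, -⟩ := Q.pairA
  obtain ⟨b, hb, -⟩ := Q.pairB
  obtain ⟨e, he⟩ := Q.neE
  unfold IsW IsU at *
  by_cases hzy : G.Adj z y
  · have := Q.gem a x y z b
    grind [G.adj_comm]
  · have := Q.pp x y z d e
    grind [G.adj_comm]

lemma adj_of_isW_of_isU_of_isU (Q : Blow G A B C D E) (hz : IsW G A B C E z)
    (hx : IsU G A B D E x) (hy : IsU G B A D C y) (hzx : G.Adj z x) (hzy : G.Adj z y) :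
    G.Adj x y := by
  by_contra h
  have hxA := fun a => Q.adjA_of_isU_of_isW hz hx (a := a)
  have hyB := fun b => Q.reflect.adjA_of_isU_of_isW hz.reflect hy (a := b)
  obtain ⟨a, ha, -⟩ := Q.pairA
  obtain ⟨b, hb, -⟩ := Q.pairB
  have := Q.gem z x a b y
  unfold IsW IsU at *
  grind [G.adj_comm]

lemma adj_of_mem_clique (Q : Blow G A B C D E) {K : Finset V} (hK : ∀ x ∈ K, IsU G A B D E x)
    (hKc : ∀ x ∈ K, ∀ y ∈ K, x ≠ y → G.Adj x y) (h2 : 2 ≤ #K) (hz : IsW G A B C E z) (hd : d ∈ D)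
    (hzd : G.Adj z d) (hx : x ∈ K) : G.Adj z x := by
  obtain ⟨y, hy, hyx⟩ := exists_mem_ne h2 x
  exact Q.adj_of_isW_of_isU hz hd hzd (hK x hx) (hK y hy) (hKc x hx y hy hyx.symm)

lemma colorableOn_union_of_isU [DecidableEq V] (Q : Blow G A B C D E) {S : Finset V} {k : ℕ}
    (hS : ∀ x ∈ S, IsU G B A D C x) (hcol : ColorableOn G S k) :
    ColorableOn G (A ∪ S ∪ C) (max (max #A #C) k) := by
  refine (((colorableOn_card A).mono subset_rfl (by simp)).union_anti
    (hcol.mono subset_rfl (le_max_right _ _)) fun x hx y hy => ?_).union_anti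
    ((colorableOn_card C).mono subset_rfl (by simp)) fun x hx y hy => ?_
  · exact fun h => (hS y hy).2.1 x hx h.symm
  · rcases mem_union.1 hx with hx | hx
    exacts [Q.antiAC x hx y hy, (hS x hx).2.2.2 y hy]

lemma not_adj_of_isT_or_isW (Q : Blow G A B C D E) (hd : d ∈ D) (hu : ∀ x ∈ D, ∀ y ∈ D, x = y)
    (hx : x = d ∨ IsT G A B C D E x ∨ IsW G A B C E x ∧ ¬ G.Adj x d)
    (hy : y = d ∨ IsT G A B C D E y ∨ IsW G A B C E y ∧ ¬ G.Adj y d) : ¬ G.Adj x y := by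
  have hanti : ∀ z, IsT G A B C D E z ∨ IsW G A B C E z ∧ ¬ G.Adj z d →
      (∀ c ∈ C, ¬ G.Adj z c) ∧ (∀ d ∈ D, ¬ G.Adj z d) ∧ ∀ e ∈ E, ¬ G.Adj z e := by
    rintro z (hz | ⟨hz, hzd⟩)
    · exact hz.2.2
    · exact ⟨hz.2.2.1, fun x hx => hu d hd x hx ▸ hzd, hz.2.2.2⟩
  rcases hx with rfl | hx <;> rcases hy with rfl | hy
  · exact G.irrefl
  · exact fun h => (hanti y hy).2.1 _ hd h.symm
  · exact (hanti x hx).2.1 _ hd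
  · obtain ⟨h1, h2, h3⟩ := hanti x hx
    obtain ⟨h4, h5, h6⟩ := hanti y hy
    exact Q.not_adj_of_anti h1 h2 h3 h4 h5 h6

lemma colorableOn_of_isW_of_adjD [Fintype V] (Q : Blow G A B C D E) (hcov : Covers G A B C D E)
    (hu : ∀ x ∈ D, ∀ y ∈ D, x = y) (hw : IsW G A B C E w) (hd : d ∈ D) (hwd : G.Adj w d) :
    ColorableOn G univ (G.cliqueNum + 1) := by
  classical
  obtain ⟨X, hX⟩ : ∃ X : Finset V, ∀ x, x ∈ X ↔ IsU G A B D E x := exists_finset_mem_iff _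
  obtain ⟨Y, hY⟩ : ∃ Y : Finset V, ∀ x, x ∈ Y ↔ IsU G B A D C x := exists_finset_mem_iff _
  obtain ⟨Z, hZ⟩ : ∃ Z : Finset V, ∀ x, x ∈ Z ↔ IsW G A B C E x ∧ G.Adj x d :=
    exists_finset_mem_iff _
  obtain ⟨R, hR⟩ : ∃ R : Finset V, ∀ x, x ∈ R ↔ x = d ∨ IsT G A B C D E x ∨
      IsW G A B C E x ∧ ¬ G.Adj x d := exists_finset_mem_iff _
  obtain ⟨K, hKS, hK, hKcol⟩ := Q.exists_clique_colorableOn_of_isU X fun x => (hX x).1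
  obtain ⟨L, hLS, hL, hLcol⟩ := Q.reflect.exists_clique_colorableOn_of_isU Y fun x => (hY x).1
  obtain ⟨S, hSZ, hS, hScol⟩ := exists_clique_colorableOn
    (Q.noP4_of_isW Z fun z hz => ((hZ z).1 hz).1)
  have hpos : 0 < #S := hScol.pos ⟨w, (hZ w).2 ⟨hw, hwd⟩⟩
  have hKU : ∀ x ∈ K, IsU G A B D E x := fun x hx => (hX x).1 (hKS hx)
  have hLU : ∀ x ∈ L, IsU G B A D C x := fun x hx => (hY x).1 (hLS hx)
  have hSW : ∀ z ∈ S, IsW G A B C E z ∧ G.Adj z d := fun z hz => (hZ z).1 (hSZ hz)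
  have hKA : ∀ x ∈ K, ∀ a ∈ A, G.Adj x a := fun x hx a => Q.adjA_of_isU_of_isW hw (hKU x hx)
  have hLB : ∀ x ∈ L, ∀ a ∈ B, G.Adj x a := fun x hx a =>
    Q.reflect.adjA_of_isU_of_isW hw.reflect (hLU x hx)
  have hSK : 2 ≤ #K → ∀ z ∈ S, ∀ x ∈ K, G.Adj z x := fun h z hz x =>
    Q.adj_of_mem_clique hKU hK h (hSW z hz).1 hd (hSW z hz).2
  have hSL : 2 ≤ #L → ∀ z ∈ S, ∀ x ∈ L, G.Adj z x := fun h z hz x =>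
    Q.reflect.adj_of_mem_clique hLU hL h (hSW z hz).1.reflect hd (hSW z hz).2
  have i1 := card_add_card_add_card_le_cliqueNum hS Q.cliqueA Q.cliqueB
    (fun z hz => (hSW z hz).1.1) (fun z hz => (hSW z hz).1.2.1) Q.adjAB
  have i2 : 2 ≤ #K → #S + #K + #A ≤ G.cliqueNum := fun h =>
    card_add_card_add_card_le_cliqueNum hS hK Q.cliqueA (hSK h)
      (fun z hz => (hSW z hz).1.1) hKA
  have i3 : 2 ≤ #L → #S + #L + #B ≤ G.cliqueNum := fun h =>
    card_add_card_add_card_le_cliqueNum hS hL Q.cliqueB (hSL h)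
      (fun z hz => (hSW z hz).1.2.1) hLB
  have i4 : 2 ≤ #K → 2 ≤ #L → #S + #K + #L ≤ G.cliqueNum := fun h h' => by
    obtain ⟨z, hz⟩ := card_pos.1 hpos
    exact card_add_card_add_card_le_cliqueNum hS hK hL (hSK h) (hSL h') fun x hx y hy =>
      Q.adj_of_isW_of_isU_of_isU (hSW z hz).1 (hKU x hx) (hLU y hy) (hSK h z hz x hx)
        (hSL h' z hz y hy)
  have hA := Q.cardA
  have hB := Q.cardB
  have hC1 : #C ≤ #A :=
    (card_le_one.2 fun x hx y hy => Q.reflect.eqE_of_isW hw.reflect hx hy).trans hA.le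
  have hE1 : #E ≤ #B := (card_le_one.2 fun x hx y hy => Q.eqE_of_isW hw hx hy).trans hB.le
  have c1 := Q.colorableOn_union_of_isU (fun x => (hY x).1) hLcol
  have c2 := Q.reflect.colorableOn_union_of_isU (fun x => (hX x).1) hKcol
  have c3 : ColorableOn G R 1 := colorableOn_one fun x hx y hy =>
    Q.not_adj_of_isT_or_isW hd hu ((hR x).1 hx) ((hR y).1 hy)
  rw [max_eq_left hC1] at c1
  rw [max_eq_left hE1] at c2
  refine (((c1.union c2).union hScol).union c3).mono ?_ (by omega)
  intro x _
  have hxd : x ∈ D → x = d := fun h => hu x h d hd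
  have h := hcov x
  have hZ := hZ x
  have hR := hR x
  simp only [mem_union, hX, hY]
  clear * - h hxd hZ hR
  by_cases hx : G.Adj x d <;> rcases h with h | h | h | h | h | h | h | h | h <;> simp_all

end Blow

lemma adj_of_exists_adj {V : Type*} {G : SimpleGraph V} {C : Finset V} {c u : V}
    (hC : ∀ x ∈ C, ∀ y ∈ C, x = y) (hc : c ∈ C) (h : ∃ x ∈ C, G.Adj u x) : G.Adj u c := by
  obtain ⟨x, hx, h⟩ := h
  rwa [hC c hc x hx]

namespace Blow

variable {V : Type*} {G : SimpleGraph V} {A B C D E : Finset V} {a b c d e t u v w x y z : V}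

lemma adj_or_adj_of_adjE (Q : Blow G A B C D E) (hx : IsU G A B D E x) (hy : IsU G A B D E y)
    (hxy : G.Adj x y) (hz : IsU G B A D C z) (he : e ∈ E) (hze : G.Adj z e) :
    G.Adj z x ∨ G.Adj z y := by
  by_contra! h
  obtain ⟨d, hd⟩ := Q.neD
  have := Q.reflect.not_mem_of_isU hz
  unfold IsU at *
  have := Q.pp x y z e d
  grind [G.adj_comm]

lemma card_add_card_le_of_adjC_of_adjE [Fintype V] (Q : Blow G A B C D E) {K L : Finset V}
    (hKU : ∀ x ∈ K, IsU G A B D E x ∧ ∃ c ∈ C, G.Adj x c)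
    (hLU : ∀ x ∈ L, IsU G B A D C x ∧ ∃ e ∈ E, G.Adj x e)
    (hK : ∀ x ∈ K, ∀ y ∈ K, x ≠ y → G.Adj x y) (hL : ∀ x ∈ L, ∀ y ∈ L, x ≠ y → G.Adj x y)
    (h3 : 3 ≤ #K) : #K + #L ≤ G.cliqueNum + 1 := by
  obtain ⟨c, hc⟩ := Q.neC
  refine card_add_card_le_cliqueNum_succ hK hL h3 ?_ ?_
  · intro u hu x hx y hy hxy h
    obtain ⟨huU, e, he, hue⟩ := hLU u hu
    exact (Q.adj_or_adj_of_adjE (hKU x hx).1 (hKU y hy).1 (hK x hx y hy hxy) huU he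
      hue).resolve_left h
  · intro x hx y hy hxy u hu v hv huv h1 h2 h3 h4
    obtain ⟨huU, e, he, hue⟩ := hLU u hu
    obtain ⟨hvU, -⟩ := hLU v hv
    have hC : ∀ x ∈ C, ∀ y ∈ C, x = y := fun x hx y hy => by
      by_contra hxy
      exact Q.not_adjE_of_isU hx hy hxy huU he hue
    have hxc := adj_of_exists_adj hC hc (hKU x hx).2
    have hyc := adj_of_exists_adj hC hc (hKU y hy).2
    unfold IsU at huU hvU
    have := Q.gem y c x u v
    grind [G.adj_comm]

lemma exists_card_lt_of_memD [Fintype V] (Q : Blow G A B C D E) (hcov : Covers G A B C D E)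
    (hu : ∀ x ∈ D, ∀ y ∈ D, x = y) (hCE : #C ≤ 1 ∨ #E ≤ 1)
    (hW : ∀ w, IsW G A B C E w → ∀ d ∈ D, ¬ G.Adj w d) (hd : d ∈ D) :
    ∃ N : Finset V, (∀ v, G.Adj d v → v ∈ N) ∧ #N < G.cliqueNum + 1 := by
  classical
  refine ⟨C ∪ E, fun v hv => ?_, ?_⟩
  · rcases hcov v with h | h | h | h | h | h | h | h | h
    · grind
    · grind
    · grind
    · exact absurd (hu d hd v h) hv.ne
    · grind
    · exact absurd hv.symm (h.2.2.2.1 d hd)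
    · exact absurd hv.symm (h.2.2.1 d hd)
    · exact absurd hv.symm (h.2.2.1 d hd)
    · exact absurd hv.symm (hW v h d hd)
  · have := card_union_le C E
    have := card_add_card_le_cliqueNum Q.cliqueB Q.cliqueC Q.adjBC
    have := card_add_card_le_cliqueNum Q.cliqueE Q.cliqueA Q.adjEA
    have := Q.cardA
    have := Q.cardB
    omega

lemma not_adj_of_isU_of_isW (Q : Blow G A B C D E)
    (hW : ∀ w, IsW G A B C E w → ∀ d ∈ D, ¬ G.Adj w d) (hx : IsU G A B D E x)
    (hw : IsW G A B C E w) : ¬ G.Adj w x := by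
  intro h
  obtain ⟨b, hb, -⟩ := Q.pairB
  obtain ⟨d, hd⟩ := Q.neD
  obtain ⟨e, he⟩ := Q.neE
  have hxB := (Q.not_mem_of_isU hx).2.1
  have hwd := hW w hw d hd
  refine hx.2.1 b hb (Q.trans_de hd he h.symm (hw.2.1 b hb) (by grind) (hx.2.2.1 d hd) hwd
    (Q.antiBD b hb d hd) (hx.2.2.2 e he) (hw.2.2.2 e he) (Q.antiBE b hb e he))

lemma exists_card_lt_of_isW [Fintype V] (Q : Blow G A B C D E) (hcov : Covers G A B C D E)
    (hW : ∀ w, IsW G A B C E w → ∀ d ∈ D, ¬ G.Adj w d) (hw : IsW G A B C E w) :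
    ∃ N : Finset V, (∀ v, G.Adj w v → v ∈ N) ∧ #N < G.cliqueNum + 1 := by
  classical
  refine ⟨A ∪ B, fun v hv => ?_, ?_⟩
  · have hwd := hW w hw
    rcases hcov v with h | h | h | h | h | h | h | h | h
    · grind
    · grind
    · exact absurd hv (hw.2.2.1 v h)
    · exact absurd hv (hwd v h)
    · exact absurd hv (hw.2.2.2 v h)
    · exact absurd hv (Q.not_adj_of_anti hw.2.2.1 hwd hw.2.2.2 h.2.2.1 h.2.2.2.1 h.2.2.2.2)
    · exact absurd hv (Q.not_adj_of_isU_of_isW hW h hw)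
    · exact absurd hv (Q.reflect.not_adj_of_isU_of_isW (fun w hw => hW w hw.reflect) h hw.reflect)
    · exact absurd hv (Q.not_adj_of_anti hw.2.2.1 hwd hw.2.2.2 h.2.2.1 (hW v h) h.2.2.2)
  · have := card_union_le A B
    have := card_add_card_le_cliqueNum Q.cliqueA Q.cliqueB Q.adjAB
    omega

lemma exists_card_lt_of_isU [Fintype V] (Q : Blow G A B C D E) (hcov : Covers G A B C D E)
    (hW : ∀ w, IsW G A B C E w → ∀ d ∈ D, ¬ G.Adj w d) (hu : IsU G A B D E u)
    (huC : ∀ c ∈ C, ¬ G.Adj u c) :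
    ∃ N : Finset V, (∀ v, G.Adj u v → v ∈ N) ∧ #N < G.cliqueNum + 1 := by
  classical
  obtain ⟨K, hK⟩ := exists_finset_mem_iff fun x => IsU G A B D E x ∧ G.Adj u x
  obtain ⟨d, hd⟩ := Q.neD
  obtain ⟨e, he⟩ := Q.neE
  obtain ⟨c, hc⟩ := Q.neC
  refine ⟨A ∪ K, fun v hv => ?_, ?_⟩
  · rcases hcov v with h | h | h | h | h | h | h | h | h
    · grind
    · exact absurd hv (hu.2.1 v h)
    · exact absurd hv (huC v h)
    · exact absurd hv (hu.2.2.1 v h)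
    · exact absurd hv (hu.2.2.2 v h)
    · exact absurd hv (Q.not_adj_of_anti huC hu.2.2.1 hu.2.2.2 h.2.2.1 h.2.2.2.1 h.2.2.2.2)
    · exact mem_union_right _ ((hK v).2 ⟨h, hv⟩)
    · obtain ⟨a, ha, hua⟩ := hu.1
      have hvA := (Q.reflect.not_mem_of_isU h).2.1
      exact absurd (Q.reflect.trans_de hd hc hv.symm hua (by grind) (h.2.2.1 d hd)
        (hu.2.2.1 d hd) (Q.antiAD a ha d hd) (h.2.2.2 c hc) (huC c hc) (Q.antiAC a ha c hc))
        (h.2.1 a ha)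
    · exact absurd hv (Q.not_adj_of_anti huC hu.2.2.1 hu.2.2.2 h.2.2.1 (hW v h) h.2.2.2)
  · have h1 := card_union_le A K
    have h2 := card_add_card_le_cliqueNum Q.cliqueE Q.cliqueA Q.adjEA
    have h3 := Q.neE.card_pos
    have huK : u ∉ K := fun h => G.irrefl ((hK u).1 h).2
    have h4 := card_insert_of_notMem huK
    by_cases h : 2 ≤ #K
    · have := Q.card_add_card_le_of_isU (K := insert u K) (L := A) (by grind)
        (fun x hx y hy hxy => by
        rcases mem_insert.1 hx with rfl | hxK <;> rcases mem_insert.1 hy with rfl | hyK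
        · exact absurd rfl hxy
        · exact ((hK y).1 hyK).2
        · exact ((hK x).1 hxK).2.symm
        · exact Q.adj_of_isU_of_isU ((hK x).1 hxK).1 hu ((hK y).1 hyK).1 ((hK x).1 hxK).2.symm
            ((hK y).1 hyK).2 hxy) (by omega) (Or.inl rfl)
      omega
    · omega

lemma adj_of_isT (Q : Blow G A B C D E) (ht : IsT G A B C D E t) (hx : IsU G A B D E x)
    (hy : IsU G A B D E y) (htx : G.Adj t x) (hty : G.Adj t y) (hxy : x ≠ y) : G.Adj x y := by
  obtain ⟨d, hd⟩ := Q.neD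
  obtain ⟨e, he⟩ := Q.neE
  exact Q.trans_de hd he htx.symm hty hxy (hx.2.2.1 d hd) (ht.2.2.2.1 d hd) (hy.2.2.1 d hd)
    (hx.2.2.2 e he) (ht.2.2.2.2 e he) (hy.2.2.2 e he)

lemma IsT.reflect (ht : IsT G A B C D E t) : IsT G B A E D C t :=
  ⟨ht.2.1, ht.1, ht.2.2.2.2, ht.2.2.2.1, ht.2.2.1⟩

lemma card_lt_of_isT [Fintype V] (Q : Blow G A B C D E) (ht : IsT G A B C D E t) {K : Finset V}
    (hK : ∀ x ∈ K, IsU G A B D E x ∧ G.Adj t x) : #K + 1 ≤ G.cliqueNum := by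
  classical
  have := card_add_card_le_cliqueNum (G := G) (K := K) (L := {t})
    (fun x hx y hy => Q.adj_of_isT ht (hK x hx).1 (hK y hy).1 (hK x hx).2 (hK y hy).2) (by simp)
    (by simpa using fun x hx => (hK x hx).2.symm)
  simpa using this

lemma exists_card_lt_of_isT [Fintype V] (Q : Blow G A B C D E) (hcov : Covers G A B C D E)
    (hW : ∀ w, IsW G A B C E w → ∀ d ∈ D, ¬ G.Adj w d) (ht : IsT G A B C D E t) :
    ∃ N : Finset V, (∀ v, G.Adj t v → v ∈ N) ∧ #N < G.cliqueNum + 1 := by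
  classical
  obtain ⟨K, hK⟩ := exists_finset_mem_iff fun x =>
    (IsU G A B D E x ∧ ∃ c ∈ C, G.Adj x c) ∧ G.Adj t x
  obtain ⟨L, hL⟩ := exists_finset_mem_iff fun x =>
    (IsU G B A D C x ∧ ∃ e ∈ E, G.Adj x e) ∧ G.Adj t x
  have hanti : ∀ v, (∀ c ∈ C, ¬ G.Adj v c) → (∀ d ∈ D, ¬ G.Adj v d) → (∀ e ∈ E, ¬ G.Adj v e) →
      ¬ G.Adj t v := fun v h1 h2 h3 =>
    Q.not_adj_of_anti ht.2.2.1 ht.2.2.2.1 ht.2.2.2.2 h1 h2 h3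
  refine ⟨K ∪ L, fun v hv => ?_, ?_⟩
  · rcases hcov v with h | h | h | h | h | h | h | h | h
    · exact absurd hv (ht.1 v h)
    · exact absurd hv (ht.2.1 v h)
    · exact absurd hv (ht.2.2.1 v h)
    · exact absurd hv (ht.2.2.2.1 v h)
    · exact absurd hv (ht.2.2.2.2 v h)
    · exact absurd hv (hanti v h.2.2.1 h.2.2.2.1 h.2.2.2.2)
    · refine mem_union_left _ ((hK v).2 ⟨⟨h, ?_⟩, hv⟩)
      by_contra! hc
      exact hanti v hc h.2.2.1 h.2.2.2 hv
    · refine mem_union_right _ ((hL v).2 ⟨⟨h, ?_⟩, hv⟩)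
      by_contra! he
      exact hanti v h.2.2.2 h.2.2.1 he hv
    · exact absurd hv (hanti v h.2.2.1 (hW v h) h.2.2.2)
  have h1 := card_union_le K L
  have h2 := Q.card_lt_of_isT ht (K := K) fun x hx => ⟨((hK x).1 hx).1.1, ((hK x).1 hx).2⟩
  have h3 := Q.reflect.card_lt_of_isT ht.reflect (K := L) fun x hx =>
    ⟨((hL x).1 hx).1.1, ((hL x).1 hx).2⟩
  by_cases hKL : 2 ≤ #K ∧ 2 ≤ #L
  · have := card_add_card_le_cliqueNum (G := G) (K := K) (L := L)
      (fun x hx y hy => Q.adj_of_isT ht ((hK x).1 hx).1.1 ((hK y).1 hy).1.1 ((hK x).1 hx).2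
        ((hK y).1 hy).2)
      (fun x hx y hy => Q.reflect.adj_of_isT ht.reflect ((hL x).1 hx).1.1 ((hL y).1 hy).1.1
        ((hL x).1 hx).2 ((hL y).1 hy).2) fun x hx w hw => by
        by_contra hxw
        obtain ⟨y, hy, hyx⟩ := exists_mem_ne hKL.1 x
        obtain ⟨⟨hxU, hxC⟩, htx⟩ := (hK x).1 hx
        obtain ⟨⟨hyU, hyC⟩, hty⟩ := (hK y).1 hy
        obtain ⟨⟨hwU, e, he, hwe⟩, htw⟩ := (hL w).1 hw
        have hC : ∀ x ∈ C, ∀ y ∈ C, x = y := fun x hx y hy => by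
          by_contra hxy
          exact Q.not_adjE_of_isU hx hy hxy hwU he hwe
        obtain ⟨c, hc⟩ := Q.neC
        have hxc := adj_of_exists_adj hC hc hxC
        have hyc := adj_of_exists_adj hC hc hyC
        have hxy := Q.adj_of_isT ht hxU hyU htx hty hyx.symm
        have hwy := (Q.adj_or_adj_of_adjE hxU hyU hxy hwU he hwe).resolve_left fun h => hxw h.symm
        exact Q.gem y c x t w hxc.symm htx.symm htw hyc hxy.symm hty.symm hwy.symm
          (fun h => ht.2.2.1 c hc h.symm) (fun h => hwU.2.2.2 c hc h.symm) hxw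
    omega
  · omega

lemma colorableOn_of_not_adjD [Fintype V] (Q : Blow G A B C D E) (hcov : Covers G A B C D E)
    (hu : ∀ x ∈ D, ∀ y ∈ D, x = y) (hCE : #C ≤ 1 ∨ #E ≤ 1)
    (hW : ∀ w, IsW G A B C E w → ∀ d ∈ D, ¬ G.Adj w d) :
    ColorableOn G univ (G.cliqueNum + 1) := by
  classical
  obtain ⟨X, hX⟩ := exists_finset_mem_iff fun x => IsU G A B D E x ∧ ∃ c ∈ C, G.Adj x c
  obtain ⟨Y, hY⟩ := exists_finset_mem_iff fun x => IsU G B A D C x ∧ ∃ e ∈ E, G.Adj x e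
  obtain ⟨R, hR⟩ := exists_finset_mem_iff fun u =>
    ∃ N : Finset V, (∀ v, G.Adj u v → v ∈ N) ∧ #N < G.cliqueNum + 1
  obtain ⟨K, hKS, hK, hKcol⟩ := Q.exists_clique_colorableOn_of_isU X fun x hx => ((hX x).1 hx).1
  obtain ⟨L, hLS, hL, hLcol⟩ :=
    Q.reflect.exists_clique_colorableOn_of_isU Y fun x hx => ((hY x).1 hx).1
  have hKU := fun x hx => (hX x).1 (hKS hx)
  have hLU := fun x hx => (hY x).1 (hLS hx)
  have c1 := Q.colorableOn_union_of_isU (fun x hx => ((hY x).1 hx).1) hLcol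
  have c2 := Q.reflect.colorableOn_union_of_isU (fun x hx => ((hX x).1 hx).1) hKcol
  have hsum : max (max #A #C) #L + max (max #B #E) #K ≤ G.cliqueNum + 1 := by
    have := Q.cardA
    have := Q.cardB
    have := card_add_card_le_cliqueNum Q.cliqueA Q.cliqueB Q.adjAB
    have := card_add_card_le_cliqueNum Q.cliqueB Q.cliqueC Q.adjBC
    have := card_add_card_le_cliqueNum Q.cliqueE Q.cliqueA Q.adjEA
    have := fun h => Q.card_add_card_le_of_isU (fun x hx => (hKU x hx).1) hK h (Or.inl rfl)
    have := fun h => Q.card_add_card_le_of_isU (fun x hx => (hKU x hx).1) hK h (Or.inr rfl)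
    have := fun h => Q.reflect.card_add_card_le_of_isU (fun x hx => (hLU x hx).1) hL h (Or.inl rfl)
    have := fun h => Q.reflect.card_add_card_le_of_isU (fun x hx => (hLU x hx).1) hL h (Or.inr rfl)
    have := Q.card_add_card_le_of_adjC_of_adjE hKU hLU hK hL
    by_cases 3 ≤ #K <;> by_cases 3 ≤ #L <;> simp_all only [forall_const] <;> omega
  refine (((c1.union c2).mono subset_rfl hsum).extend R fun u => (hR u).1).mono ?_ le_rfl
  intro v _
  simp only [mem_union]
  rcases hcov v with h | h | h | h | h | h | h | h | h
  · simp [h]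
  · simp [h]
  · simp [h]
  · exact Or.inr ((hR v).2 (Q.exists_card_lt_of_memD hcov hu hCE hW h))
  · simp [h]
  · exact Or.inr ((hR v).2 (Q.exists_card_lt_of_isT hcov hW h))
  · by_cases hc : ∃ c ∈ C, G.Adj v c
    · simp [(hX v).2 ⟨h, hc⟩]
    · push Not at hc
      exact Or.inr ((hR v).2 (Q.exists_card_lt_of_isU hcov hW h hc))
  · by_cases he : ∃ e ∈ E, G.Adj v e
    · simp [(hY v).2 ⟨h, he⟩]
    · push Not at he
      exact Or.inr ((hR v).2 (Q.reflect.exists_card_lt_of_isU hcov.reflect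
        (fun w hw => hW w hw.reflect) h he))
  · exact Or.inr ((hR v).2 (Q.exists_card_lt_of_isW hcov hW h))

lemma inClassC_or_colorableOn [Fintype V] (Q : Blow G A B C D E) (hcov : Covers G A B C D E) :
    InClassC G ∨ ColorableOn G univ (G.cliqueNum + 1) := by
  by_cases hU : (∀ u, ¬ IsU G A B D E u) ∧ ∀ u, ¬ IsU G B A D C u
  · by_cases hW : ∃ w, IsW G A B C E w
    · obtain ⟨w, hw⟩ := hW
      exact Or.inr (Q.colorableOn_of_not_isU hcov hU.1 hU.2 hw)
    · exact Or.inl (Q.inClassC hcov hU.1 hU.2 (not_exists.1 hW))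
  · right
    obtain ⟨hu, hCE⟩ : (∀ x ∈ D, ∀ y ∈ D, x = y) ∧ (#C ≤ 1 ∨ #E ≤ 1) := by
      rw [not_and_or] at hU
      push Not at hU
      rcases hU with ⟨u, hu⟩ | ⟨u, hu⟩
      · exact ⟨fun x hx y hy => Q.eqD_of_isU hu hx hy, Q.cardC_le_or_cardE_le_of_isU hu⟩
      · exact ⟨fun x hx y hy => Q.reflect.eqD_of_isU hu hx hy,
          (Q.reflect.cardC_le_or_cardE_le_of_isU hu).symm⟩
    by_cases hW : ∃ w, IsW G A B C E w ∧ ∃ d ∈ D, G.Adj w d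
    · obtain ⟨w, hw, d, hd, hwd⟩ := hW
      exact Q.colorableOn_of_isW_of_adjD hcov hu hw hd hwd
    · push Not at hW
      exact Q.colorableOn_of_not_adjD hcov hu hCE hW

end Blow

end GemFree

/-- A (P2+P3, gem)-free graph containing an induced `F1'` is in `𝒞` or satisfies
`χ(G) ≤ ω(G) + 1`. -/
theorem inClassC_or_chi_le_of_F1' {V : Type*} [Fintype V] (G : SimpleGraph V)
    (h1 : IsFreeOf G graphP2P3) (h2 : IsFreeOf G graphGem)
    (hF : Nonempty (graphF1' ↪g G)) :
    InClassC G ∨ G.chromaticNumber ≤ (G.cliqueNum : ℕ∞) + 1 := by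
  obtain ⟨A, B, C, D, E, Q⟩ := GemFree.Blow.of_F1' (GemFree.noGem_of_isFreeOf h2)
    (GemFree.noP2P3_of_isFreeOf h1) hF
  obtain ⟨A, B, C, D, E, Q, hcov⟩ := Q.exists_covers
  exact (Q.inClassC_or_colorableOn hcov).imp_right fun h => by
    exact_mod_cast h.chromaticNumber_le
end

section
/- Let G be a (P2+P3, gem)-free graph. If G contains an induced F1'', then either G belongs to the class 𝒞 or χ(G) ≤ ω(G) + 1. -/
open SimpleGraph

/-- `G` has no gem with hub `h` and path `a b c d`. -/
def NoGem {V : Type*} (G : SimpleGraph V) : Prop :=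
  ∀ h a b c d : V, ¬ (G.Adj h a ∧ G.Adj h b ∧ G.Adj h c ∧ G.Adj h d ∧
    G.Adj a b ∧ G.Adj b c ∧ G.Adj c d ∧ ¬ G.Adj a c ∧ ¬ G.Adj a d ∧ ¬ G.Adj b d)

/-- `G` has no edge `p q` anticomplete to an induced path `a b c`. -/
def NoP2P3 {V : Type*} (G : SimpleGraph V) : Prop :=
  ∀ p q a b c : V, ¬ (G.Adj p q ∧ G.Adj a b ∧ G.Adj b c ∧ a ≠ c ∧ ¬ G.Adj a c ∧
    ¬ G.Adj p a ∧ ¬ G.Adj p b ∧ ¬ G.Adj p c ∧ ¬ G.Adj q a ∧ ¬ G.Adj q b ∧ ¬ G.Adj q c)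

section FiveCycleBlowup

variable {V : Type*} {G : SimpleGraph V}

theorem nonempty_embedding_of_lt {n : ℕ} {H : SimpleGraph (Fin n)} (w : Fin n → V)
    (hw : ∀ i j, i < j → w i ≠ w j ∧ (G.Adj (w i) (w j) ↔ H.Adj i j)) :
    Nonempty (H ↪g G) := by
  refine ⟨⟨⟨w, ?_⟩, ?_⟩⟩
  · intro i j hij
    rcases lt_trichotomy i j with h | h | h
    · exact absurd hij (hw i j h).1
    · exact h
    · exact absurd hij.symm (hw j i h).1
  · intro i j
    rcases lt_trichotomy i j with h | h | h
    · exact (hw i j h).2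
    · subst h
      simp
    · rw [G.adj_comm, H.adj_comm]
      exact (hw j i h).2

theorem noGem_of_isFreeOf (h : IsFreeOf G graphGem) : NoGem G := by
  rintro x a b c d ⟨xa, xb, xc, xd, ab, bc, cd, ac, ad, bd⟩
  have h1 : a ≠ c := by rintro rfl; exact ad cd
  have h2 : a ≠ d := by rintro rfl; exact bd ab.symm
  have h3 : b ≠ d := by rintro rfl; exact ad ab
  refine not_isEmpty_iff.2 (nonempty_embedding_of_lt ![a, b, c, d, x] ?_) h
  intro i j hij
  fin_cases i <;> fin_cases j <;>
    simp [graphGem, ab, bc, cd, ac, ad, bd, xa.symm, xb.symm, xc.symm, xd.symm, ab.ne, bc.ne,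
      cd.ne, xa.ne', xb.ne', xc.ne', xd.ne', h1, h2, h3] at hij ⊢

theorem noP2P3_of_isFreeOf (h : IsFreeOf G graphP2P3) : NoP2P3 G := by
  rintro p q a b c ⟨pq, ab, bc, hac, ac, pa, pb, pc, qa, qb, qc⟩
  have h1 : p ≠ a := by rintro rfl; exact qa pq.symm
  have h2 : p ≠ b := by rintro rfl; exact qb pq.symm
  have h3 : p ≠ c := by rintro rfl; exact qc pq.symm
  have h4 : q ≠ a := by rintro rfl; exact pa pq
  have h5 : q ≠ b := by rintro rfl; exact pb pq
  have h6 : q ≠ c := by rintro rfl; exact pc pq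
  refine not_isEmpty_iff.2 (nonempty_embedding_of_lt ![p, q, a, b, c] ?_) h
  intro i j hij
  fin_cases i <;> fin_cases j <;>
    simp [graphP2P3, pq, ab, bc, ac, pa, pb, pc, qa, qb, qc, pq.ne, ab.ne, bc.ne, hac, h1, h2,
      h3, h4, h5, h6] at hij ⊢

/-- `f` colors the vertices of `S` properly. -/
def ProperOn (G : SimpleGraph V) (S : Finset V) (f : V → ℕ) : Prop :=
  ∀ x ∈ S, ∀ y ∈ S, G.Adj x y → f x ≠ f y

open Classical in
/-- In a `P4`-free graph the chromatic number is at most the clique number: every maximal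
stable set meets every maximum clique. -/
theorem exists_properOn_of_p4Free [Fintype V] (k : ℕ) (S : Finset V)
    (hP : ∀ w ∈ S, ∀ x ∈ S, ∀ y ∈ S, ∀ z ∈ S, ¬ (G.Adj w x ∧ G.Adj x y ∧ G.Adj y z ∧
      ¬ G.Adj w y ∧ ¬ G.Adj w z ∧ ¬ G.Adj x z))
    (hk : ∀ K ⊆ S, G.IsClique (K : Set V) → K.card ≤ k) :
    ∃ f : V → ℕ, (∀ x ∈ S, f x < k) ∧ ProperOn G S f := by
  induction k generalizing S with
  | zero =>
    have hS : S = ∅ := by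
      rw [Finset.eq_empty_iff_forall_notMem]
      intro x hx
      have := hk {x} (by simpa using hx) (by simp)
      simp at this
    subst hS
    exact ⟨fun _ => 0, by simp, by simp [ProperOn]⟩
  | succ k ih =>
    obtain ⟨I, hI⟩ : ∃ I : Finset V, Maximal
        (fun I : Finset V => I ⊆ S ∧ ∀ x ∈ I, ∀ y ∈ I, ¬ G.Adj x y) I := by
      have hfin : {I : Finset V | I ⊆ S ∧ ∀ x ∈ I, ∀ y ∈ I, ¬ G.Adj x y}.Finite := Set.toFinite _
      exact hfin.exists_maximal ⟨∅, by simp⟩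
    obtain ⟨⟨hIS, hst⟩, hmax⟩ := hI
    have hdom : ∀ x ∈ S, x ∉ I → ∃ j ∈ I, G.Adj x j := by
      intro x hx hxI
      by_contra! hno
      have := hmax (y := insert x I) ⟨by grind, by
        intro y hy z hz hyz
        rcases Finset.mem_insert.1 hy with h1 | h1 <;> rcases Finset.mem_insert.1 hz with h2 | h2
        · exact G.irrefl (h1 ▸ h2 ▸ hyz)
        · exact hno z h2 (h1 ▸ hyz)
        · exact hno y h1 (h2 ▸ hyz).symm
        · exact hst y h1 z h2 hyz⟩ (by simp)
      exact hxI (this (by simp))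
    obtain ⟨f, hf, hp⟩ := ih (S \ I) (fun w hw x hx y hy z hz => hP w (by grind) x (by grind) y
      (by grind) z (by grind)) (by
      intro K hKS hK
      have hle := hk K (by grind) hK
      by_contra! hlt
      have hcard : K.card = k + 1 := by omega
      have hKne : K.Nonempty := Finset.card_pos.1 (by omega)
      obtain ⟨x₀, hx₀⟩ := hKne
      obtain ⟨j₀, hj₀, -⟩ := hdom x₀ (by grind) (by grind)
      obtain ⟨i, hi, himax⟩ := Finset.exists_max_image I (fun i => (K.filter (G.Adj i)).card)
        ⟨j₀, hj₀⟩
      have hmiss : ∃ x ∈ K, ¬ G.Adj i x := by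
        by_contra! hall
        have hiK : i ∉ K := by grind
        have := hk (insert i K) (by grind) (by
          rw [Finset.coe_insert, SimpleGraph.isClique_insert]
          exact ⟨hK, fun b hb _ => hall b hb⟩)
        rw [Finset.card_insert_of_notMem hiK] at this
        omega
      obtain ⟨x, hxK, hix⟩ := hmiss
      obtain ⟨j, hj, hxj⟩ := hdom x (by grind) (by grind)
      have hy : ∃ y ∈ K, G.Adj i y ∧ ¬ G.Adj j y := by
        by_contra! hall
        have : K.filter (G.Adj i) ⊂ K.filter (G.Adj j) := by
          rw [Finset.ssubset_iff_of_subset (by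
            intro y hy
            simp only [Finset.mem_filter] at hy ⊢
            exact ⟨hy.1, hall y hy.1 hy.2⟩)]
          exact ⟨x, by simp [hxK, hxj.symm], by simp [hix]⟩
        exact absurd (himax j hj) (not_le.2 (Finset.card_lt_card this))
      obtain ⟨y, hyK, hiy, hjy⟩ := hy
      have hxy : y ≠ x := by rintro rfl; exact hix hiy
      exact hP i (hIS hi) y (by grind) x (by grind) j (hIS hj)
        ⟨hiy, hK (by simpa using hyK) (by simpa using hxK) hxy, hxj, hix, hst i hi j hj,
          fun h => hjy h.symm⟩)
    refine ⟨fun x => if x ∈ I then k else f x, ?_, ?_⟩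
    · intro x hx
      by_cases hxI : x ∈ I
      · simp [hxI]
      · have := hf x (by grind)
        simp only [hxI, if_false]; omega
    · intro x hx y hy hxy
      by_cases hxI : x ∈ I <;> by_cases hyI : y ∈ I
      · exact absurd hxy (hst x hxI y hyI)
      · have := hf y (by grind)
        simp only [hxI, hyI, if_true, if_false]; omega
      · have := hf x (by grind)
        simp only [hxI, hyI, if_true, if_false]; omega
      · simpa [hxI, hyI] using hp x (by grind) y (by grind) hxy

/-- The sets `A`, `B`, `C`, `D`, `E` are the parts, in cyclic order, of a clique blowup of `C5`
induced in `G`. -/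
structure C5Blowup (G : SimpleGraph V) (A B C D E : Finset V) : Prop where
  neA : A.Nonempty
  neB : B.Nonempty
  neC : C.Nonempty
  neD : D.Nonempty
  neE : E.Nonempty
  clA : ∀ x ∈ A, ∀ y ∈ A, x ≠ y → G.Adj x y
  clB : ∀ x ∈ B, ∀ y ∈ B, x ≠ y → G.Adj x y
  clC : ∀ x ∈ C, ∀ y ∈ C, x ≠ y → G.Adj x y
  clD : ∀ x ∈ D, ∀ y ∈ D, x ≠ y → G.Adj x y
  clE : ∀ x ∈ E, ∀ y ∈ E, x ≠ y → G.Adj x y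
  adjAB : ∀ x ∈ A, ∀ y ∈ B, G.Adj x y
  adjBC : ∀ x ∈ B, ∀ y ∈ C, G.Adj x y
  adjCD : ∀ x ∈ C, ∀ y ∈ D, G.Adj x y
  adjDE : ∀ x ∈ D, ∀ y ∈ E, G.Adj x y
  adjEA : ∀ x ∈ E, ∀ y ∈ A, G.Adj x y
  notAC : ∀ x ∈ A, ∀ y ∈ C, ¬ G.Adj x y
  notBD : ∀ x ∈ B, ∀ y ∈ D, ¬ G.Adj x y
  notCE : ∀ x ∈ C, ∀ y ∈ E, ¬ G.Adj x y
  notDA : ∀ x ∈ D, ∀ y ∈ A, ¬ G.Adj x y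
  notEB : ∀ x ∈ E, ∀ y ∈ B, ¬ G.Adj x y

namespace C5Blowup

variable {A B C D E : Finset V}

theorem rotate (S : C5Blowup G A B C D E) : C5Blowup G B C D E A :=
  ⟨S.neB, S.neC, S.neD, S.neE, S.neA, S.clB, S.clC, S.clD, S.clE, S.clA,
    S.adjBC, S.adjCD, S.adjDE, S.adjEA, S.adjAB, S.notBD, S.notCE, S.notDA, S.notEB, S.notAC⟩

theorem mirror (S : C5Blowup G A B C D E) : C5Blowup G C B A E D :=
  ⟨S.neC, S.neB, S.neA, S.neE, S.neD, S.clC, S.clB, S.clA, S.clE, S.clD,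
    fun x hx y hy => (S.adjBC y hy x hx).symm, fun x hx y hy => (S.adjAB y hy x hx).symm,
    fun x hx y hy => (S.adjEA y hy x hx).symm, fun x hx y hy => (S.adjDE y hy x hx).symm,
    fun x hx y hy => (S.adjCD y hy x hx).symm,
    fun x hx y hy h => S.notAC y hy x hx h.symm, fun x hx y hy h => S.notEB y hy x hx h.symm,
    fun x hx y hy h => S.notDA y hy x hx h.symm, fun x hx y hy h => S.notCE y hy x hx h.symm,
    fun x hx y hy h => S.notBD y hy x hx h.symm⟩

theorem insert_left [DecidableEq V] (S : C5Blowup G A B C D E) (hg : NoGem G) (hp : NoP2P3 G)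
    {u a b c d e : V} (ha : a ∈ A) (hb : b ∈ B) (hc : c ∈ C) (hd : d ∈ D) (he : e ∈ E)
    (ue : G.Adj u e) (ua : G.Adj u a) (ub : G.Adj u b) (uc : ¬ G.Adj u c) (ud : ¬ G.Adj u d) :
    C5Blowup G (insert u A) B C D E := by
  have hE : ∀ x ∈ E, G.Adj u x := by
    intro x hx
    have := hg a x e u b
    obtain ⟨⟩ := S
    grind [G.adj_comm]
  have hB : ∀ x ∈ B, G.Adj u x := by
    intro x hx
    have := hg a x b u e
    obtain ⟨⟩ := S
    grind [G.adj_comm]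
  have hC : ∀ x ∈ C, ¬ G.Adj u x := by
    intro x hx
    have := hg b a u x c
    obtain ⟨⟩ := S
    grind [G.adj_comm]
  have hD : ∀ x ∈ D, ¬ G.Adj u x := by
    intro x hx
    have := hg e a u x d
    obtain ⟨⟩ := S
    grind [G.adj_comm]
  have hA : ∀ x ∈ A, u ≠ x → G.Adj u x := by
    intro x hx hne
    have := hp c d u a x
    obtain ⟨⟩ := S
    grind [G.adj_comm]
  obtain ⟨⟩ := S
  constructor <;> first | assumption | exact Finset.insert_nonempty u A | grind [G.adj_comm]

end C5Blowup

/-- A clique blowup of `C5` in a `(P2 + P3, gem)`-free graph, with at least two vertices in the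
parts `A` and `C`, that contains each vertex whose neighbours on some transversal of the parts
are three consecutive vertices. -/
structure ClosedBlowup (G : SimpleGraph V) (A B C D E : Finset V) : Prop
    extends C5Blowup G A B C D E where
  noGem : NoGem G
  noP2P3 : NoP2P3 G
  two_le_A : 2 ≤ A.card
  two_le_C : 2 ≤ C.card
  memA : ∀ u, ∀ a ∈ A, ∀ b ∈ B, ∀ c ∈ C, ∀ d ∈ D, ∀ e ∈ E,
    G.Adj u e → G.Adj u a → G.Adj u b → ¬ G.Adj u c → ¬ G.Adj u d → u ∈ A
  memB : ∀ u, ∀ a ∈ A, ∀ b ∈ B, ∀ c ∈ C, ∀ d ∈ D, ∀ e ∈ E,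
    G.Adj u a → G.Adj u b → G.Adj u c → ¬ G.Adj u d → ¬ G.Adj u e → u ∈ B
  memC : ∀ u, ∀ a ∈ A, ∀ b ∈ B, ∀ c ∈ C, ∀ d ∈ D, ∀ e ∈ E,
    G.Adj u b → G.Adj u c → G.Adj u d → ¬ G.Adj u e → ¬ G.Adj u a → u ∈ C
  memD : ∀ u, ∀ a ∈ A, ∀ b ∈ B, ∀ c ∈ C, ∀ d ∈ D, ∀ e ∈ E,
    G.Adj u c → G.Adj u d → G.Adj u e → ¬ G.Adj u a → ¬ G.Adj u b → u ∈ D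
  memE : ∀ u, ∀ a ∈ A, ∀ b ∈ B, ∀ c ∈ C, ∀ d ∈ D, ∀ e ∈ E,
    G.Adj u d → G.Adj u e → G.Adj u a → ¬ G.Adj u b → ¬ G.Adj u c → u ∈ E

open Classical in
theorem exists_closedBlowup [Fintype V] (hg : NoGem G) (hp : NoP2P3 G)
    (h : ∃ A B C D E : Finset V, C5Blowup G A B C D E ∧ 2 ≤ A.card ∧ 2 ≤ C.card) :
    ∃ A B C D E : Finset V, ClosedBlowup G A B C D E := by
  let P : ℕ → Prop := fun n => ∃ A B C D E : Finset V, (C5Blowup G A B C D E ∧ 2 ≤ A.card ∧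
    2 ≤ C.card) ∧ A.card + B.card + C.card + D.card + E.card = n
  obtain ⟨A, B, C, D, E, h⟩ := h
  have hspec : P (Nat.findGreatest P (5 * Fintype.card V)) := by
    refine Nat.findGreatest_spec (P := P) ?_ ⟨A, B, C, D, E, h, rfl⟩
    have := A.card_le_univ; have := B.card_le_univ; have := C.card_le_univ
    have := D.card_le_univ; have := E.card_le_univ
    omega
  obtain ⟨A, B, C, D, E, ⟨S, hA, hC⟩, hn⟩ := hspec
  have hmax : ∀ A' B' C' D' E' : Finset V, C5Blowup G A' B' C' D' E' → 2 ≤ A'.card →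
      2 ≤ C'.card → A'.card + B'.card + C'.card + D'.card + E'.card ≤
        A.card + B.card + C.card + D.card + E.card := by
    intro A' B' C' D' E' S' hA' hC'
    rw [hn]
    refine Nat.le_findGreatest ?_ ⟨A', B', C', D', E', ⟨S', hA', hC'⟩, rfl⟩
    have := A'.card_le_univ; have := B'.card_le_univ; have := C'.card_le_univ
    have := D'.card_le_univ; have := E'.card_le_univ
    omega
  refine ⟨A, B, C, D, E, S, hg, hp, hA, hC, ?_, ?_, ?_, ?_, ?_⟩
  · intro u a ha b hb c hc d hd e he h1 h2 h3 h4 h5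
    by_contra hu
    have := hmax _ _ _ _ _ (S.insert_left hg hp ha hb hc hd he h1 h2 h3 h4 h5)
    grind [Finset.card_insert_of_notMem]
  · intro u a ha b hb c hc d hd e he h1 h2 h3 h4 h5
    by_contra hu
    have := hmax _ _ _ _ _
      (S.rotate.insert_left hg hp hb hc hd he ha h1 h2 h3 h4 h5).rotate.rotate.rotate.rotate
    grind [Finset.card_insert_of_notMem]
  · intro u a ha b hb c hc d hd e he h1 h2 h3 h4 h5
    by_contra hu
    have := hmax _ _ _ _ _
      (S.rotate.rotate.insert_left hg hp hc hd he ha hb h1 h2 h3 h4 h5).rotate.rotate.rotate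
    grind [Finset.card_insert_of_notMem]
  · intro u a ha b hb c hc d hd e he h1 h2 h3 h4 h5
    by_contra hu
    have := hmax _ _ _ _ _
      (S.rotate.rotate.rotate.insert_left hg hp hd he ha hb hc h1 h2 h3 h4 h5).rotate.rotate
    grind [Finset.card_insert_of_notMem]
  · intro u a ha b hb c hc d hd e he h1 h2 h3 h4 h5
    by_contra hu
    have := hmax _ _ _ _ _
      (S.rotate.rotate.rotate.rotate.insert_left hg hp he ha hb hc hd h1 h2 h3 h4 h5).rotate
    grind [Finset.card_insert_of_notMem]

/-- The vertex `u` lies in none of the five sets. -/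
def IsOutside (A B C D E : Finset V) (u : V) : Prop :=
  u ∉ A ∧ u ∉ B ∧ u ∉ C ∧ u ∉ D ∧ u ∉ E

theorem IsOutside.mirror {A B C D E : Finset V} {u : V} (hu : IsOutside A B C D E u) :
    IsOutside C B A E D u :=
  ⟨hu.2.2.1, hu.2.1, hu.1, hu.2.2.2.2, hu.2.2.2.1⟩

namespace ClosedBlowup

variable {A B C D E : Finset V} {u w r s : V}

theorem mirror (S : ClosedBlowup G A B C D E) : ClosedBlowup G C B A E D where
  toC5Blowup := S.toC5Blowup.mirror
  noGem := S.noGem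
  noP2P3 := S.noP2P3
  two_le_A := S.two_le_C
  two_le_C := S.two_le_A
  memA u a ha b hb c hc d hd e he h1 h2 h3 h4 h5 :=
    S.memC u c hc b hb a ha e he d hd h3 h2 h1 h5 h4
  memB u a ha b hb c hc d hd e he h1 h2 h3 h4 h5 :=
    S.memB u c hc b hb a ha e he d hd h3 h2 h1 h5 h4
  memC u a ha b hb c hc d hd e he h1 h2 h3 h4 h5 :=
    S.memA u c hc b hb a ha e he d hd h3 h2 h1 h5 h4
  memD u a ha b hb c hc d hd e he h1 h2 h3 h4 h5 :=
    S.memE u c hc b hb a ha e he d hd h3 h2 h1 h5 h4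
  memE u a ha b hb c hc d hd e he h1 h2 h3 h4 h5 :=
    S.memD u c hc b hb a ha e he d hd h3 h2 h1 h5 h4

theorem exists_ne_mem_A (S : ClosedBlowup G A B C D E) (a : V) : ∃ x ∈ A, x ≠ a :=
  Finset.exists_mem_ne (by have := S.two_le_A; omega) a

theorem exists_ne_mem_C (S : ClosedBlowup G A B C D E) (c : V) : ∃ x ∈ C, x ≠ c :=
  S.mirror.exists_ne_mem_A c

theorem adj_frame (S : ClosedBlowup G A B C D E) {a a₁ b c c₁ d e : V} (ha : a ∈ A)
    (ha₁ : a₁ ∈ A) (haa : a₁ ≠ a) (hb : b ∈ B) (hc : c ∈ C) (hc₁ : c₁ ∈ C) (hcc : c₁ ≠ c)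
    (hd : d ∈ D) (he : e ∈ E) :
    (G.Adj a a₁ ∧ G.Adj a b ∧ G.Adj a₁ b ∧ G.Adj b c ∧ G.Adj b c₁ ∧ G.Adj c c₁ ∧ G.Adj c d ∧
      G.Adj c₁ d ∧ G.Adj d e ∧ G.Adj e a ∧ G.Adj e a₁) ∧
    ¬ G.Adj a c ∧ ¬ G.Adj a c₁ ∧ ¬ G.Adj a₁ c ∧ ¬ G.Adj a₁ c₁ ∧ ¬ G.Adj b d ∧ ¬ G.Adj c e ∧
      ¬ G.Adj c₁ e ∧ ¬ G.Adj d a ∧ ¬ G.Adj d a₁ ∧ ¬ G.Adj e b :=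
  ⟨⟨S.clA _ ha _ ha₁ haa.symm, S.adjAB _ ha _ hb, S.adjAB _ ha₁ _ hb, S.adjBC _ hb _ hc,
    S.adjBC _ hb _ hc₁, S.clC _ hc _ hc₁ hcc.symm, S.adjCD _ hc _ hd, S.adjCD _ hc₁ _ hd,
    S.adjDE _ hd _ he, S.adjEA _ he _ ha, S.adjEA _ he _ ha₁⟩, S.notAC _ ha _ hc,
    S.notAC _ ha _ hc₁, S.notAC _ ha₁ _ hc, S.notAC _ ha₁ _ hc₁, S.notBD _ hb _ hd,
    S.notCE _ hc _ he, S.notCE _ hc₁ _ he, S.notDA _ hd _ ha, S.notDA _ hd _ ha₁,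
    S.notEB _ he _ hb⟩

theorem adj_frame_D (S : ClosedBlowup G A B C D E) {a a₁ b c c₁ d d₁ e : V} (ha : a ∈ A)
    (ha₁ : a₁ ∈ A) (hb : b ∈ B) (hc : c ∈ C) (hc₁ : c₁ ∈ C) (hd : d ∈ D) (hd₁ : d₁ ∈ D)
    (hdd : d₁ ≠ d) (he : e ∈ E) :
    (G.Adj d d₁ ∧ G.Adj c d₁ ∧ G.Adj c₁ d₁ ∧ G.Adj d₁ e) ∧
      ¬ G.Adj b d₁ ∧ ¬ G.Adj d₁ a ∧ ¬ G.Adj d₁ a₁ :=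
  ⟨⟨S.clD _ hd _ hd₁ hdd.symm, S.adjCD _ hc _ hd₁, S.adjCD _ hc₁ _ hd₁, S.adjDE _ hd₁ _ he⟩,
    S.notBD _ hb _ hd₁, S.notDA _ hd₁ _ ha, S.notDA _ hd₁ _ ha₁⟩

/-- A vertex outside the blowup with a neighbour in `B` has no neighbour in the other parts. -/
theorem not_adj_of_adj_B (S : ClosedBlowup G A B C D E) (hu : IsOutside A B C D E u)
    {b : V} (hb : b ∈ B) (ub : G.Adj u b) :
    (∀ x ∈ A, ¬ G.Adj u x) ∧ (∀ x ∈ C, ¬ G.Adj u x) ∧ (∀ x ∈ D, ¬ G.Adj u x) ∧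
      ∀ x ∈ E, ¬ G.Adj u x := by
  have key : ∀ a ∈ A, ∀ c ∈ C, ∀ d ∈ D, ∀ e ∈ E,
      ¬ G.Adj u a ∧ ¬ G.Adj u c ∧ ¬ G.Adj u d ∧ ¬ G.Adj u e := by
    intro a ha c hc d hd e he
    obtain ⟨a₁, ha₁, haa⟩ := S.exists_ne_mem_A a
    obtain ⟨c₁, hc₁, hcc⟩ := S.exists_ne_mem_C c
    have g1 := S.noGem a e a₁ b u
    have g2 := S.noGem b a a₁ u c
    have g3 := S.noGem u b a e d
    have g4 := S.noGem b a₁ u c₁ c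
    have g5 := S.noGem c d c₁ b u
    have g6 := S.noGem u c₁ b a e
    have g7 := S.noGem u a b c d
    have g8 := S.noGem u b c d e
    have p1 := S.noP2P3 a a₁ c d u
    have p2 := S.noP2P3 a a₁ d c₁ u
    have p3 := S.noP2P3 c c₁ a a₁ u
    have p4 := S.noP2P3 u c₁ a₁ e u
    have p5 := S.noP2P3 c c₁ e a u
    have p6 := S.noP2P3 c c₁ a₁ e u
    have y1 := S.memA u a ha b hb c hc d hd e he
    have y2 := S.memB u a ha b hb c hc d hd e he
    have y3 := S.memC u a ha b hb c hc d hd e he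
    have fr := S.adj_frame ha ha₁ haa hb hc hc₁ hcc hd he
    have hG := G.adj_comm
    clear S
    obtain ⟨uA, uB, uC, uD, uE⟩ := hu
    grind (splits := 40)
  obtain ⟨a, ha⟩ := S.neA
  obtain ⟨c, hc⟩ := S.neC
  obtain ⟨d, hd⟩ := S.neD
  obtain ⟨e, he⟩ := S.neE
  exact ⟨fun x hx => (key x hx c hc d hd e he).1, fun x hx => (key a ha x hx d hd e he).2.1,
    fun x hx => (key a ha c hc x hx e he).2.2.1, fun x hx => (key a ha c hc d hd x hx).2.2.2⟩

/-- A vertex outside the blowup that is not complete to `A`, not complete to `C` and has no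
neighbour in `B` has no neighbour in the blowup. -/
theorem not_adj_of_not_adj_A_C (S : ClosedBlowup G A B C D E) (hu : IsOutside A B C D E u)
    (hB : ∀ x ∈ B, ¬ G.Adj u x) {a₁ c₁ : V} (ha₁ : a₁ ∈ A) (hc₁ : c₁ ∈ C)
    (ua₁ : ¬ G.Adj u a₁) (uc₁ : ¬ G.Adj u c₁) :
    (∀ x ∈ A, ¬ G.Adj u x) ∧ (∀ x ∈ C, ¬ G.Adj u x) ∧ (∀ x ∈ D, ¬ G.Adj u x) ∧
      ∀ x ∈ E, ¬ G.Adj u x := by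
  have key : ∀ a ∈ A, a ≠ a₁ → ∀ c ∈ C, c ≠ c₁ → ∀ d ∈ D, ∀ e ∈ E,
      ¬ G.Adj u a ∧ ¬ G.Adj u c ∧ ¬ G.Adj u d ∧ ¬ G.Adj u e := by
    intro a ha haa c hc hcc d hd e he
    obtain ⟨b, hb⟩ := S.neB
    have ub := hB b hb
    have g1 := S.noGem a b a₁ e u
    have p1 := S.noP2P3 a a₁ c₁ c u
    have p2 := S.noP2P3 a a₁ c d u
    have p3 := S.noP2P3 a₁ e c₁ c u
    have p4 := S.noP2P3 c c₁ a₁ a u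
    have p5 := S.noP2P3 c c₁ a e u
    have fr := S.adj_frame ha ha₁ haa.symm hb hc hc₁ hcc.symm hd he
    have hG := G.adj_comm
    clear S hB
    obtain ⟨uA, uB, uC, uD, uE⟩ := hu
    grind (splits := 40)
  obtain ⟨a, ha, haa⟩ := S.exists_ne_mem_A a₁
  obtain ⟨c, hc, hcc⟩ := S.exists_ne_mem_C c₁
  obtain ⟨d, hd⟩ := S.neD
  obtain ⟨e, he⟩ := S.neE
  refine ⟨fun x hx => ?_, fun x hx => ?_, fun x hx => (key a ha haa c hc hcc x hx e he).2.2.1,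
    fun x hx => (key a ha haa c hc hcc d hd x hx).2.2.2⟩
  · by_cases h : x = a₁
    · exact h ▸ ua₁
    · exact (key x hx h c hc hcc d hd e he).1
  · by_cases h : x = c₁
    · exact h ▸ uc₁
    · exact (key a ha haa x hx h d hd e he).2.1

/-- A vertex outside the blowup that is complete to `C`, not complete to `A` and has no
neighbour in `B` has no neighbour in `E`. -/
theorem not_adj_E (S : ClosedBlowup G A B C D E) (hu : IsOutside A B C D E u)
    (hB : ∀ x ∈ B, ¬ G.Adj u x) (hC : ∀ x ∈ C, G.Adj u x) {a₁ : V} (ha₁ : a₁ ∈ A)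
    (ua₁ : ¬ G.Adj u a₁) : ∀ x ∈ E, ¬ G.Adj u x := by
  intro e he
  obtain ⟨a, ha, haa⟩ := S.exists_ne_mem_A a₁
  obtain ⟨b, hb⟩ := S.neB
  obtain ⟨c, hc⟩ := S.neC
  obtain ⟨c₁, hc₁, hcc⟩ := S.exists_ne_mem_C c
  obtain ⟨d, hd⟩ := S.neD
  have ub := hB b hb
  have uc := hC c hc
  have uc₁ := hC c₁ hc₁
  have g1 := S.noGem a b a₁ e u
  have p1 := S.noP2P3 a a₁ d c u
  have y1 := S.memD u a ha b hb c hc d hd e he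
  have y2 := S.memD u a₁ ha₁ b hb c hc d hd e he
  have fr := S.adj_frame ha ha₁ haa.symm hb hc hc₁ hcc hd he
  have hG := G.adj_comm
  clear S hB hC
  obtain ⟨uA, uB, uC, uD, uE⟩ := hu
  grind (splits := 40)

/-- If `D` has two vertices, then a vertex outside the blowup that is complete to `A` and has no
neighbour in `B` is complete to `C`. -/
theorem adj_C_of_one_lt_card_D (S : ClosedBlowup G A B C D E) (hD : 1 < D.card)
    (hu : IsOutside A B C D E u) (hB : ∀ x ∈ B, ¬ G.Adj u x) (hA : ∀ x ∈ A, G.Adj u x) :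
    ∀ x ∈ C, G.Adj u x := by
  intro c₁ hc₁
  by_contra uc₁
  obtain ⟨c, hc, hcc⟩ := S.exists_ne_mem_C c₁
  obtain ⟨a, ha⟩ := S.neA
  obtain ⟨a₁, ha₁, haa⟩ := S.exists_ne_mem_A a
  obtain ⟨b, hb⟩ := S.neB
  obtain ⟨d, hd⟩ := S.neD
  obtain ⟨d₁, hd₁, hdd⟩ := Finset.exists_mem_ne hD d
  obtain ⟨e, he⟩ := S.neE
  have ub := hB b hb
  have ua := hA a ha
  have ua₁ := hA a₁ ha₁
  have g1 := S.noGem c b c₁ d u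
  have g2 := S.noGem c b c₁ d₁ u
  have g3 := S.noGem d c d₁ e u
  have p1 := S.noP2P3 c c₁ e a u
  have p2 := S.noP2P3 d d₁ b a u
  have y1 := S.memE u a ha b hb c₁ hc₁ d₁ hd₁ e he
  have y2 := S.memE u a ha b hb c₁ hc₁ d hd e he
  have fr := S.adj_frame ha ha₁ haa hb hc hc₁ hcc.symm hd he
  have fr' := S.adj_frame_D ha ha₁ hb hc hc₁ hd hd₁ hdd he
  have hG := G.adj_comm
  clear S hB hA
  obtain ⟨uA, uB, uC, uD, uE⟩ := hu
  grind (splits := 40)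

/-- If `D` has two vertices, then a vertex outside the blowup that is complete to `C` and has no
neighbour in `B` is complete to `D`. -/
theorem adj_D_of_one_lt_card_D (S : ClosedBlowup G A B C D E) (hD : 1 < D.card)
    (hu : IsOutside A B C D E u) (hB : ∀ x ∈ B, ¬ G.Adj u x) (hC : ∀ x ∈ C, G.Adj u x) :
    ∀ x ∈ D, G.Adj u x := by
  intro d hd
  obtain ⟨d₁, hd₁, hdd⟩ := Finset.exists_mem_ne hD d
  obtain ⟨a, ha⟩ := S.neA
  obtain ⟨a₁, ha₁, haa⟩ := S.exists_ne_mem_A a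
  obtain ⟨b, hb⟩ := S.neB
  obtain ⟨c, hc⟩ := S.neC
  obtain ⟨c₁, hc₁, hcc⟩ := S.exists_ne_mem_C c
  obtain ⟨e, he⟩ := S.neE
  have ub := hB b hb
  have uc := hC c hc
  have uc₁ := hC c₁ hc₁
  have g1 := S.noGem d₁ e d c u
  have g2 := S.noGem a₁ b a e u
  have g3 := S.noGem e a u d₁ d
  have p1 := S.noP2P3 d d₁ b a u
  have p2 := S.noP2P3 a a₁ d c u
  have p3 := S.noP2P3 d d₁ a a₁ u
  have fr := S.adj_frame ha ha₁ haa hb hc hc₁ hcc hd he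
  have fr' := S.adj_frame_D ha ha₁ hb hc hc₁ hd hd₁ hdd he
  have hG := G.adj_comm
  clear S hB hC
  obtain ⟨uA, uB, uC, uD, uE⟩ := hu
  grind (splits := 40)

/-- If `D` has two vertices, then no vertex outside the blowup has a neighbour in `B`. -/
theorem not_adj_B_of_one_lt_card_D (S : ClosedBlowup G A B C D E) (hD : 1 < D.card)
    (hu : IsOutside A B C D E u) : ∀ x ∈ B, ¬ G.Adj u x := by
  intro b hb ub
  obtain ⟨hA, -, hD', -⟩ := S.not_adj_of_adj_B hu hb ub
  obtain ⟨a, ha⟩ := S.neA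
  obtain ⟨d, hd⟩ := S.neD
  obtain ⟨d₁, hd₁, hdd⟩ := Finset.exists_mem_ne hD d
  exact S.noP2P3 d d₁ u b a ⟨S.clD _ hd _ hd₁ hdd.symm, ub, (S.adjAB _ ha _ hb).symm,
    fun h => hu.1 (h ▸ ha), hA a ha, fun h => hD' d hd h.symm, fun h => S.notBD _ hb _ hd h.symm,
    S.notDA _ hd _ ha, fun h => hD' d₁ hd₁ h.symm, fun h => S.notBD _ hb _ hd₁ h.symm,
    S.notDA _ hd₁ _ ha⟩

/-- Two adjacent vertices complete to `A` and `C` have the same neighbours in `D`. -/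
theorem adj_D_of_adj (S : ClosedBlowup G A B C D E) (hrA : ∀ x ∈ A, G.Adj r x)
    (hrC : ∀ x ∈ C, G.Adj r x) (hsA : ∀ x ∈ A, G.Adj s x) (hsC : ∀ x ∈ C, G.Adj s x)
    (rs : G.Adj r s) {d : V} (hd : d ∈ D) (sd : G.Adj s d) : G.Adj r d := by
  by_contra rd
  obtain ⟨a, ha⟩ := S.neA
  obtain ⟨c, hc⟩ := S.neC
  exact S.noGem s a r c d ⟨hsA a ha, rs.symm, hsC c hc, sd, (hrA a ha).symm, hrC c hc,
    S.adjCD _ hc _ hd, S.notAC _ ha _ hc, fun h => S.notDA _ hd _ ha h.symm, rd⟩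

/-- A vertex complete to `A` and `C` with a nonneighbour in `E` is adjacent to each vertex that is
complete to `A` and not complete to `C`. -/
theorem adj_of_not_adj_E (S : ClosedBlowup G A B C D E) (hr : IsOutside A B C D E r)
    (hs : IsOutside A B C D E s)
    (hrB : ∀ x ∈ B, ¬ G.Adj r x) (hsB : ∀ x ∈ B, ¬ G.Adj s x)
    (hrC : ∀ x ∈ C, G.Adj r x) (hsA : ∀ x ∈ A, G.Adj s x)
    (hsC : ∀ x ∈ C, ¬ G.Adj s x) {e : V} (he : e ∈ E) (re : ¬ G.Adj r e)
    (hrA : ∀ x ∈ A, G.Adj r x) : G.Adj r s := by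
  obtain ⟨a, ha⟩ := S.neA
  obtain ⟨b, hb⟩ := S.neB
  obtain ⟨c, hc⟩ := S.neC
  obtain ⟨c₁, hc₁, hcc⟩ := S.exists_ne_mem_C c
  obtain ⟨a₁, ha₁, haa⟩ := S.exists_ne_mem_A a
  obtain ⟨d, hd⟩ := S.neD
  have rb := hrB b hb
  have sb := hsB b hb
  have rc := hrC c hc
  have rc₁ := hrC c₁ hc₁
  have sa := hsA a ha
  have ra := hrA a ha
  have sc := hsC c hc
  have sc₁ := hsC c₁ hc₁
  have p1 := S.noP2P3 c c₁ e a s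
  have p2 := S.noP2P3 e s b c r
  have fr := S.adj_frame ha ha₁ haa hb hc hc₁ hcc hd he
  have hG := G.adj_comm
  obtain ⟨uA, uB, uC, uD, uE⟩ := hr
  obtain ⟨sA, sB, sC, sD, sE⟩ := hs
  clear S hrB hsB hrC hsA hsC hrA
  grind (splits := 40)

/-- If some vertex is complete to `A` and not complete to `C`, then a vertex that is complete to
`C` and not complete to `A` has no neighbour in `A`. -/
theorem not_adj_A (S : ClosedBlowup G A B C D E) (hr : IsOutside A B C D E r)
    (hs : IsOutside A B C D E s) (hrB : ∀ x ∈ B, ¬ G.Adj r x) (hsB : ∀ x ∈ B, ¬ G.Adj s x)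
    (hrC : ∀ x ∈ C, G.Adj r x) (hsA : ∀ x ∈ A, G.Adj s x) {a₁ c₁ : V} (ha₁ : a₁ ∈ A)
    (hc₁ : c₁ ∈ C) (ra₁ : ¬ G.Adj r a₁) (sc₁ : ¬ G.Adj s c₁) : ∀ x ∈ A, ¬ G.Adj r x := by
  intro a ha ra
  have haa : a₁ ≠ a := by rintro rfl; exact ra₁ ra
  obtain ⟨b, hb⟩ := S.neB
  obtain ⟨c, hc, hcc⟩ := S.exists_ne_mem_C c₁
  obtain ⟨d, hd⟩ := S.neD
  obtain ⟨e, he⟩ := S.neE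
  have rb := hrB b hb
  have sb := hsB b hb
  have rc := hrC c hc
  have rc₁ := hrC c₁ hc₁
  have sa := hsA a ha
  have sa₁ := hsA a₁ ha₁
  have g1 := S.noGem a b a₁ e r
  have g2 := S.noGem a b a₁ s r
  have p1 := S.noP2P3 c₁ r e a₁ s
  have p2 := S.noP2P3 e s b c₁ r
  have fr := S.adj_frame ha ha₁ haa hb hc hc₁ hcc.symm hd he
  have hG := G.adj_comm
  obtain ⟨uA, uB, uC, uD, uE⟩ := hr
  obtain ⟨sA, sB, sC, sD, sE⟩ := hs
  clear S hrB hsB hrC hsA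
  grind (splits := 40)

/-- Two vertices of which neither has a neighbour in three consecutive parts are not adjacent. -/
theorem not_adj_of_anticomplete_EAB (S : C5Blowup G A B C D E) (hp : NoP2P3 G) {a b e : V}
    (ha : a ∈ A) (hb : b ∈ B) (he : e ∈ E) (ua : ¬ G.Adj u a) (ub : ¬ G.Adj u b)
    (ue : ¬ G.Adj u e) (wa : ¬ G.Adj w a) (wb : ¬ G.Adj w b) (we : ¬ G.Adj w e) :
    ¬ G.Adj u w := by
  intro uw
  obtain ⟨d, hd⟩ := S.neD
  have hbe : b ≠ e := by rintro rfl; exact S.notBD _ hb _ hd (S.adjDE _ hd _ he).symm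
  exact hp u w b a e ⟨uw, (S.adjAB _ ha _ hb).symm, (S.adjEA _ he _ ha).symm, hbe,
    fun h => S.notEB _ he _ hb h.symm, ub, ua, ue, wb, wa, we⟩

/-- Adjacent vertices without neighbours in `B` that share a neighbour in `A` have the same
neighbours in `A`. -/
theorem adj_A_of_adj (S : ClosedBlowup G A B C D E) {a a₁ b : V} (ha : a ∈ A) (ha₁ : a₁ ∈ A)
    (hb : b ∈ B) (uw : G.Adj u w) (ub : ¬ G.Adj u b) (wb : ¬ G.Adj w b) (ua : G.Adj u a)
    (wa : G.Adj w a) (wa₁ : G.Adj w a₁) : G.Adj u a₁ := by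
  by_contra ua₁
  have haa : a ≠ a₁ := by rintro rfl; exact ua₁ ua
  exact S.noGem a u w a₁ b ⟨ua.symm, wa.symm, S.clA _ ha _ ha₁ haa, S.adjAB _ ha _ hb, uw, wa₁,
    S.adjAB _ ha₁ _ hb, ua₁, ub, wb⟩

end ClosedBlowup

theorem card_add_card_le [DecidableEq V] {k : ℕ}
    (hk : ∀ K : Finset V, G.IsClique (K : Set V) → K.card ≤ k) {K L : Finset V}
    (hK : G.IsClique (K : Set V)) (hL : ∀ x ∈ L, ∀ y ∈ L, x ≠ y → G.Adj x y)
    (hKL : ∀ x ∈ K, ∀ y ∈ L, G.Adj x y) : K.card + L.card ≤ k := by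
  rw [← Finset.card_union_of_disjoint]
  · refine hk _ ?_
    intro x hx y hy hxy
    simp only [Finset.coe_union, Set.mem_union, Finset.mem_coe] at hx hy
    rcases hx with hx | hx <;> rcases hy with hy | hy
    · exact hK hx hy hxy
    · exact hKL x hx y hy
    · exact (hKL y hy x hx).symm
    · exact hL x hx y hy hxy
  · rw [Finset.disjoint_left]
    exact fun x hx hx' => G.irrefl (hKL x hx x hx')

theorem exists_index (X : Finset V) :
    ∃ i : V → ℕ, (∀ x ∈ X, i x < X.card) ∧ ∀ x ∈ X, ∀ y ∈ X, i x = i y → x = y := by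
  classical
  refine ⟨fun x => if h : x ∈ X then (X.equivFin ⟨x, h⟩ : ℕ) else 0, ?_, ?_⟩
  · intro x hx
    simp [hx]
  · intro x hx y hy h
    simpa [hx, hy, Fin.val_inj] using h

theorem colorable_of_forall_exists {k : ℕ} (col : V → ℕ → Prop) (h : ∀ x, ∃ n ≤ k, col x n)
    (hcol : ∀ x y n, G.Adj x y → col x n → ¬ col y n) : G.Colorable (k + 1) := by
  choose f hf hcf using h
  refine ⟨Coloring.mk (fun x => (⟨f x, Nat.lt_succ_of_le (hf x)⟩ : Fin (k + 1))) ?_⟩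
  intro x y hxy he
  have hxy' : f x = f y := Fin.val_eq_of_eq he
  exact hcol x y (f x) hxy (hcf x) (hxy' ▸ hcf y)

/-- A vertex outside the blowup whose neighbours in the blowup lie in `B`. -/
structure IsRemote (G : SimpleGraph V) (A B C D E : Finset V) (u : V) : Prop where
  outside : IsOutside A B C D E u
  notA : ∀ x ∈ A, ¬ G.Adj u x
  notC : ∀ x ∈ C, ¬ G.Adj u x
  notD : ∀ x ∈ D, ¬ G.Adj u x
  notE : ∀ x ∈ E, ¬ G.Adj u x

/-- A vertex outside the blowup that is complete to `C`, not complete to `A` and has no neighbour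
in `B`. -/
structure IsHalfJoined (G : SimpleGraph V) (A B C D E : Finset V) (u : V) : Prop where
  outside : IsOutside A B C D E u
  notB : ∀ x ∈ B, ¬ G.Adj u x
  adjC : ∀ x ∈ C, G.Adj u x
  exists_notA : ∃ x ∈ A, ¬ G.Adj u x

/-- A vertex outside the blowup that is complete to `A` and `C` and has no neighbour in `B`. -/
structure IsJoined (G : SimpleGraph V) (A B C D E : Finset V) (u : V) : Prop where
  outside : IsOutside A B C D E u
  notB : ∀ x ∈ B, ¬ G.Adj u x
  adjA : ∀ x ∈ A, G.Adj u x
  adjC : ∀ x ∈ C, G.Adj u x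

namespace ClosedBlowup

variable {A B C D E : Finset V} {u w r s : V}

theorem mem_or_isOutside (A B C D E : Finset V) (u : V) :
    u ∈ A ∨ u ∈ B ∨ u ∈ C ∨ u ∈ D ∨ u ∈ E ∨ IsOutside A B C D E u := by
  unfold IsOutside
  tauto

theorem isRemote_or (S : ClosedBlowup G A B C D E) (hu : IsOutside A B C D E u) :
    IsRemote G A B C D E u ∨ IsHalfJoined G A B C D E u ∨ IsHalfJoined G C B A E D u ∨
      IsJoined G A B C D E u := by
  by_cases hB : ∀ x ∈ B, ¬ G.Adj u x
  · by_cases hA : ∀ x ∈ A, G.Adj u x <;> by_cases hC : ∀ x ∈ C, G.Adj u x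
    · exact Or.inr (Or.inr (Or.inr ⟨hu, hB, hA, hC⟩))
    · push Not at hC
      exact Or.inr (Or.inr (Or.inl ⟨hu.mirror, hB, hA, hC⟩))
    · push Not at hA
      exact Or.inr (Or.inl ⟨hu, hB, hC, hA⟩)
    · push Not at hA hC
      obtain ⟨a, ha, ua⟩ := hA
      obtain ⟨c, hc, uc⟩ := hC
      obtain ⟨h1, h2, h3, h4⟩ := S.not_adj_of_not_adj_A_C hu hB ha hc ua uc
      exact Or.inl ⟨hu, h1, h2, h3, h4⟩
  · push Not at hB
    obtain ⟨b, hb, ub⟩ := hB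
    obtain ⟨h1, h2, h3, h4⟩ := S.not_adj_of_adj_B hu hb ub
    exact Or.inl ⟨hu, h1, h2, h3, h4⟩

theorem not_adj_of_isRemote (S : ClosedBlowup G A B C D E) (hu : IsRemote G A B C D E u)
    (hw : IsRemote G A B C D E w) : ¬ G.Adj u w := by
  obtain ⟨c, hc⟩ := S.neC
  obtain ⟨d, hd⟩ := S.neD
  obtain ⟨e, he⟩ := S.neE
  exact not_adj_of_anticomplete_EAB S.rotate.rotate.rotate S.noP2P3 hd he hc
    (hu.notD d hd) (hu.notE e he) (hu.notC c hc) (hw.notD d hd) (hw.notE e he) (hw.notC c hc)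

theorem isHalfJoined_not_adj_E (S : ClosedBlowup G A B C D E) (hu : IsHalfJoined G A B C D E u) :
    ∀ x ∈ E, ¬ G.Adj u x := by
  obtain ⟨a, ha, ua⟩ := hu.exists_notA
  exact S.not_adj_E hu.outside hu.notB hu.adjC ha ua

/-- Half-joined vertices with a common nonneighbour in `A` are not adjacent. -/
theorem not_adj_of_isHalfJoined (S : ClosedBlowup G A B C D E) (hu : IsHalfJoined G A B C D E u)
    (hw : IsHalfJoined G A B C D E w) {a : V} (ha : a ∈ A) (ua : ¬ G.Adj u a)
    (wa : ¬ G.Adj w a) : ¬ G.Adj u w := by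
  obtain ⟨b, hb⟩ := S.neB
  obtain ⟨e, he⟩ := S.neE
  exact not_adj_of_anticomplete_EAB S.toC5Blowup S.noP2P3 ha hb he ua (hu.notB b hb)
    (S.isHalfJoined_not_adj_E hu e he) wa (hw.notB b hb) (S.isHalfJoined_not_adj_E hw e he)

/-- Half-joined vertices with a common neighbour in `A` are not adjacent. -/
theorem not_adj_of_isHalfJoined' (S : ClosedBlowup G A B C D E) (hu : IsHalfJoined G A B C D E u)
    (hw : IsHalfJoined G A B C D E w) {a : V} (ha : a ∈ A) (ua : G.Adj u a)
    (wa : G.Adj w a) : ¬ G.Adj u w := by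
  intro uw
  obtain ⟨a₁, ha₁, ua₁⟩ := hu.exists_notA
  obtain ⟨b, hb⟩ := S.neB
  by_cases wa₁ : G.Adj w a₁
  · exact ua₁ (S.adj_A_of_adj ha ha₁ hb uw (hu.notB b hb) (hw.notB b hb) ua wa wa₁)
  · exact S.not_adj_of_isHalfJoined hu hw ha₁ ua₁ wa₁ uw

theorem not_adj_of_isHalfJoined_of_isJoined (S : ClosedBlowup G A B C D E)
    (hu : IsHalfJoined G A B C D E u) (hw : IsJoined G A B C D E w) {a : V} (ha : a ∈ A)
    (ua : G.Adj u a) : ¬ G.Adj u w := by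
  intro uw
  obtain ⟨a₁, ha₁, ua₁⟩ := hu.exists_notA
  obtain ⟨b, hb⟩ := S.neB
  exact ua₁ (S.adj_A_of_adj ha ha₁ hb uw (hu.notB b hb) (hw.notB b hb) ua (hw.adjA a ha)
    (hw.adjA a₁ ha₁))

theorem exists_properOn_isJoined [Fintype V] (S : ClosedBlowup G A B C D E) (R : Finset V)
    (hR : ∀ x ∈ R, IsJoined G A B C D E x) (m : ℕ)
    (hm : ∀ K ⊆ R, G.IsClique (K : Set V) → K.card ≤ m) :
    ∃ f : V → ℕ, (∀ x ∈ R, f x < m) ∧ ProperOn G R f := by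
  obtain ⟨a, ha⟩ := S.neA
  refine exists_properOn_of_p4Free m R ?_ hm
  rintro w hw x hx y hy z hz ⟨wx, xy, yz, wy, wz, xz⟩
  exact S.noGem a w x y z ⟨((hR w hw).adjA a ha).symm, ((hR x hx).adjA a ha).symm,
    ((hR y hy).adjA a ha).symm, ((hR z hz).adjA a ha).symm, wx, xy, yz, wy, wz, xz⟩

end ClosedBlowup

namespace ClosedBlowup

variable {A B C D E : Finset V}

set_option maxHeartbeats 4000000 in
open Classical in
/-- The coloring when `E` is a single vertex, no vertex is complete to `A` but not to `C`, and
each remaining vertex is complete or anticomplete to `D`. -/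
theorem colorable_of_card_E_eq_one [Fintype V] (S : ClosedBlowup G A B C D E) {k : ℕ}
    (hk : ∀ K : Finset V, G.IsClique (K : Set V) → K.card ≤ k) (hE : E.card = 1)
    (hA : ∀ u, ¬ IsHalfJoined G C B A E D u)
    (hDH : ∀ u, IsHalfJoined G A B C D E u → ∀ d ∈ D, G.Adj u d → ∀ x ∈ D, G.Adj u x)
    (hDJ : ∀ u, IsJoined G A B C D E u → ∀ d ∈ D, G.Adj u d → ∀ x ∈ D, G.Adj u x) :
    G.Colorable (k + 1) := by
  obtain ⟨a₀, ha₀⟩ := S.neA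
  obtain ⟨iA, hiA, hiA'⟩ := exists_index A
  obtain ⟨iB, hiB, hiB'⟩ := exists_index B
  obtain ⟨iC, hiC, hiC'⟩ := exists_index C
  obtain ⟨iD, hiD, hiD'⟩ := exists_index D
  have clA : G.IsClique (A : Set V) := fun x hx y hy => S.clA x hx y hy
  have clC : G.IsClique (C : Set V) := fun x hx y hy => S.clC x hx y hy
  have hAB : A.card + B.card ≤ k := card_add_card_le hk clA S.clB S.adjAB
  have hCB : C.card + B.card ≤ k :=
    card_add_card_le hk clC S.clB fun x hx y hy => (S.adjBC y hy x hx).symm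
  have hCD : C.card + D.card ≤ k := card_add_card_le hk clC S.clD S.adjCD
  have hB : 0 < B.card := S.neB.card_pos
  have hA2 := S.two_le_A
  have hC2 := S.two_le_C
  have hE1 : ∀ x ∈ E, ∀ y ∈ E, x = y := Finset.card_le_one.1 hE.le
  have hHD : ∀ u, IsHalfJoined G A B C D E u → ∀ d ∈ D, G.Adj u d → C.card + D.card + 1 ≤ k := by
    intro u hu d hd ud
    have := card_add_card_le (K := insert u C) (L := D) hk ?_ S.clD ?_
    · rw [Finset.card_insert_of_notMem hu.outside.2.2.1] at this
      omega
    · rw [Finset.coe_insert, isClique_insert]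
      exact ⟨clC, fun b hb _ => hu.adjC b hb⟩
    · intro x hx y hy
      rcases Finset.mem_insert.1 hx with rfl | hx
      · exact hDH x hu d hd ud y hy
      · exact S.adjCD x hx y hy
  obtain ⟨f, hf, hf'⟩ := S.exists_properOn_isJoined
    (Finset.univ.filter fun u => IsJoined G A B C D E u ∧ ∀ x ∈ D, ¬ G.Adj u x)
    (fun x hx => (Finset.mem_filter.1 hx).2.1) (k - max A.card C.card) (by
      intro K hK hKc
      have h1 := card_add_card_le hk hKc S.clA fun x hx y hy =>
        (Finset.mem_filter.1 (hK hx)).2.1.adjA y hy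
      have h2 := card_add_card_le hk hKc S.clC fun x hx y hy =>
        (Finset.mem_filter.1 (hK hx)).2.1.adjC y hy
      omega)
  obtain ⟨g, hg, hg'⟩ := S.exists_properOn_isJoined
    (Finset.univ.filter fun u => IsJoined G A B C D E u ∧ ∀ x ∈ D, G.Adj u x)
    (fun x hx => (Finset.mem_filter.1 hx).2.1) (k - max A.card (C.card + D.card)) (by
      intro K hK hKc
      have h1 := card_add_card_le hk hKc S.clA fun x hx y hy =>
        (Finset.mem_filter.1 (hK hx)).2.1.adjA y hy
      have h2 := card_add_card_le (L := C ∪ D) hk hKc (by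
        intro x hx y hy hxy
        rcases Finset.mem_union.1 hx with hx | hx <;> rcases Finset.mem_union.1 hy with hy | hy
        · exact S.clC x hx y hy hxy
        · exact S.adjCD x hx y hy
        · exact (S.adjCD y hy x hx).symm
        · exact S.clD x hx y hy hxy) fun x hx y hy => by
        rcases Finset.mem_union.1 hy with hy | hy
        · exact (Finset.mem_filter.1 (hK hx)).2.1.adjC y hy
        · exact (Finset.mem_filter.1 (hK hx)).2.2 y hy
      have hdisj : Disjoint C D :=
        Finset.disjoint_left.2 fun x hx hx' => G.irrefl (S.adjCD x hx x hx')
      rw [Finset.card_union_of_disjoint hdisj] at h2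
      omega)
  simp only [Finset.mem_filter, Finset.mem_univ, true_and] at hf hg
  simp only [ProperOn, Finset.mem_filter, Finset.mem_univ, true_and] at hf' hg'
  have hfg : ∀ u w, IsJoined G A B C D E u → IsJoined G A B C D E w → (∀ x ∈ D, ¬ G.Adj u x) →
      (∀ x ∈ D, G.Adj w x) → ¬ G.Adj u w := by
    intro u w hu hw huD hwD uw
    obtain ⟨d, hd⟩ := S.neD
    exact huD d hd (S.adj_D_of_adj hu.adjA hu.adjC hw.adjA hw.adjC uw hd (hwD d hd))
  have hRem := fun u w => S.not_adj_of_isRemote (u := u) (w := w)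
  have hHE := fun u => S.isHalfJoined_not_adj_E (u := u)
  have hHH := fun u w hu hw => S.not_adj_of_isHalfJoined (u := u) (w := w) hu hw ha₀
  have hHH' := fun u w hu hw => S.not_adj_of_isHalfJoined' (u := u) (w := w) hu hw ha₀
  have hHJ := fun u w hu hw => S.not_adj_of_isHalfJoined_of_isJoined (u := u) (w := w) hu hw ha₀
  refine colorable_of_forall_exists (fun x n =>
    (x ∈ A ∧ n = iA x) ∨ (x ∈ C ∧ n = iC x) ∨ (x ∈ D ∧ n = C.card + iD x) ∨ (x ∈ E ∧ n = k) ∨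
    (x ∈ B ∧ n = k - iB x) ∨ (IsRemote G A B C D E x ∧ n = 0) ∨
    (IsHalfJoined G A B C D E x ∧ G.Adj x a₀ ∧ n = k - 1) ∨
    (IsHalfJoined G A B C D E x ∧ ¬ G.Adj x a₀ ∧ n = k) ∨
    (IsJoined G A B C D E x ∧ (∀ y ∈ D, ¬ G.Adj x y) ∧ n = max A.card C.card + f x) ∨
    (IsJoined G A B C D E x ∧ (∀ y ∈ D, G.Adj x y) ∧ n = max A.card (C.card + D.card) + g x))
    ?_ ?_
  · intro x
    rcases mem_or_isOutside A B C D E x with h | h | h | h | h | h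
    · have := hiA x h
      exact ⟨iA x, by omega, .inl ⟨h, rfl⟩⟩
    · exact ⟨k - iB x, by omega, .inr (.inr (.inr (.inr (.inl ⟨h, rfl⟩))))⟩
    · have := hiC x h
      exact ⟨iC x, by omega, .inr (.inl ⟨h, rfl⟩)⟩
    · have := hiD x h
      exact ⟨C.card + iD x, by omega, .inr (.inr (.inl ⟨h, rfl⟩))⟩
    · exact ⟨k, le_rfl, .inr (.inr (.inr (.inl ⟨h, rfl⟩)))⟩
    · rcases S.isRemote_or h with h | h | h | h
      · exact ⟨0, by omega, .inr (.inr (.inr (.inr (.inr (.inl ⟨h, rfl⟩)))))⟩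
      · by_cases hx : G.Adj x a₀
        · exact ⟨k - 1, by omega, .inr (.inr (.inr (.inr (.inr (.inr (.inl ⟨h, hx, rfl⟩))))))⟩
        · exact ⟨k, le_rfl,
            .inr (.inr (.inr (.inr (.inr (.inr (.inr (.inl ⟨h, hx, rfl⟩)))))))⟩
      · exact absurd h (hA x)
      · by_cases hD : ∀ y ∈ D, ¬ G.Adj x y
        · have := hf x ⟨h, hD⟩
          exact ⟨max A.card C.card + f x, by omega,
            .inr (.inr (.inr (.inr (.inr (.inr (.inr (.inr (.inl ⟨h, hD, rfl⟩))))))))⟩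
        · push Not at hD
          obtain ⟨d, hd, xd⟩ := hD
          have hD' := hDJ x h d hd xd
          have := hg x ⟨h, hD'⟩
          exact ⟨max A.card (C.card + D.card) + g x, by omega,
            .inr (.inr (.inr (.inr (.inr (.inr (.inr (.inr (.inr ⟨h, hD', rfl⟩))))))))⟩
  · intro x y n hxy hx hy
    have hyx := hxy.symm
    have hne := hxy.ne
    have hRA : ∀ u, IsRemote G A B C D E u → ∀ x ∈ A, ¬ G.Adj u x := fun _ h => h.notA
    have hRC : ∀ u, IsRemote G A B C D E u → ∀ x ∈ C, ¬ G.Adj u x := fun _ h => h.notC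
    have hRD : ∀ u, IsRemote G A B C D E u → ∀ x ∈ D, ¬ G.Adj u x := fun _ h => h.notD
    have hRE : ∀ u, IsRemote G A B C D E u → ∀ x ∈ E, ¬ G.Adj u x := fun _ h => h.notE
    have hHB : ∀ u, IsHalfJoined G A B C D E u → ∀ x ∈ B, ¬ G.Adj u x := fun _ h => h.notB
    have hJB : ∀ u, IsJoined G A B C D E u → ∀ x ∈ B, ¬ G.Adj u x := fun _ h => h.notB
    have hAC := S.notAC
    have hDA := S.notDA
    have hBD := S.notBD
    have hCE := S.notCE
    have hEB := S.notEB
    clear hk S hA hDH hDJ clA clC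
    set a := A.card
    set b := B.card
    set c := C.card
    set d := D.card
    clear_value a b c d
    rcases hx with hx | hx | hx | hx | hx | hx | hx | hx | hx | hx <;>
    rcases hy with hy | hy | hy | hy | hy | hy | hy | hy | hy | hy
    all_goals grind (splits := 20)

end ClosedBlowup

namespace ClosedBlowup

variable {A B C D E : Finset V} {p q : V}

set_option maxHeartbeats 4000000 in
open Classical in
/-- The coloring when `D` and `E` are single vertices and half-joined vertices of both kinds
exist. -/
theorem colorable_of_isHalfJoined [Fintype V] (S : ClosedBlowup G A B C D E) {k : ℕ}
    (hk : ∀ K : Finset V, G.IsClique (K : Set V) → K.card ≤ k) (hD : D.card = 1)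
    (hE : E.card = 1) (hCA : C.card ≤ A.card) (hp : IsHalfJoined G A B C D E p)
    (hq : IsHalfJoined G C B A E D q) : G.Colorable (k + 1) := by
  have hpA : ∀ u, IsHalfJoined G A B C D E u → ∀ x ∈ A, ¬ G.Adj u x := by
    intro u hu
    obtain ⟨a, ha, ua⟩ := hu.exists_notA
    obtain ⟨c, hc, qc⟩ := hq.exists_notA
    exact S.not_adj_A hu.outside hq.outside.mirror hu.notB hq.notB hu.adjC hq.adjC ha hc ua qc
  have hqC : ∀ u, IsHalfJoined G C B A E D u → ∀ x ∈ C, ¬ G.Adj u x := by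
    intro u hu
    obtain ⟨c, hc, uc⟩ := hu.exists_notA
    obtain ⟨a, ha, pa⟩ := hp.exists_notA
    exact S.mirror.not_adj_A hu.outside hp.outside.mirror hu.notB hp.notB hu.adjC hp.adjC hc ha
      uc pa
  obtain ⟨a₀, ha₀⟩ := S.neA
  obtain ⟨c₀, hc₀⟩ := S.neC
  obtain ⟨e, he⟩ := S.neE
  obtain ⟨iA, hiA, hiA'⟩ := exists_index A
  obtain ⟨iB, hiB, hiB'⟩ := exists_index B
  obtain ⟨iC, hiC, hiC'⟩ := exists_index C
  have clA : G.IsClique (A : Set V) := fun x hx y hy => S.clA x hx y hy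
  have hAB : A.card + B.card ≤ k := card_add_card_le hk clA S.clB S.adjAB
  have hB : 0 < B.card := S.neB.card_pos
  have hA2 := S.two_le_A
  have hC2 := S.two_le_C
  have hD1 : ∀ x ∈ D, ∀ y ∈ D, x = y := Finset.card_le_one.1 hD.le
  have hE1 : ∀ x ∈ E, ∀ y ∈ E, x = y := Finset.card_le_one.1 hE.le
  obtain ⟨f, hf, hf'⟩ := S.exists_properOn_isJoined
    (Finset.univ.filter fun u => IsJoined G A B C D E u)
    (fun x hx => (Finset.mem_filter.1 hx).2) (k - 1 - A.card) (by
      intro K hK hKc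
      replace hK : ∀ x ∈ K, IsJoined G A B C D E x := fun x hx => (Finset.mem_filter.1 (hK hx)).2
      have key : ∀ v ∉ A, (∀ x ∈ A, G.Adj v x) → (∀ x ∈ K, G.Adj x v) →
          K.card ≤ k - 1 - A.card := by
        intro v hv hvA hKv
        have := card_add_card_le (L := insert v A) hk hKc (by
          intro x hx y hy hxy
          rcases Finset.mem_insert.1 hx with rfl | hx' <;>
            rcases Finset.mem_insert.1 hy with rfl | hy'
          · exact absurd rfl hxy
          · exact hvA y hy'
          · exact (hvA x hx').symm
          · exact S.clA x hx' y hy' hxy) (by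
          intro x hx y hy
          rcases Finset.mem_insert.1 hy with rfl | hy
          · exact hKv x hx
          · exact (hK x hx).adjA y hy)
        rw [Finset.card_insert_of_notMem hv] at this
        omega
      by_cases h : ∀ r ∈ K, G.Adj r e
      · exact key e (fun heA => G.irrefl (S.adjEA e he e heA)) (S.adjEA e he) h
      · push Not at h
        obtain ⟨r₀, hr₀, re₀⟩ := h
        refine key q hq.outside.2.2.1 hq.adjC fun r hr => ?_
        have re : ¬ G.Adj r e := by
          intro re
          have hne : r₀ ≠ r := by rintro rfl; exact re₀ re
          exact re₀ (S.mirror.adj_D_of_adj (hK r₀ hr₀).adjC (hK r₀ hr₀).adjA (hK r hr).adjC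
            (hK r hr).adjA (hKc hr₀ hr hne) he re)
        exact S.adj_of_not_adj_E (hK r hr).outside hq.outside.mirror (hK r hr).notB hq.notB
          (hK r hr).adjC hq.adjC (hqC q hq) he re (hK r hr).adjA)
  simp only [Finset.mem_filter, Finset.mem_univ, true_and] at hf
  simp only [ProperOn, Finset.mem_filter, Finset.mem_univ, true_and] at hf'
  have hRem := fun u w => S.not_adj_of_isRemote (u := u) (w := w)
  have hHE := fun u => S.isHalfJoined_not_adj_E (u := u)
  have hHD := fun u => S.mirror.isHalfJoined_not_adj_E (u := u)
  have hHH := fun u w hu hw => S.not_adj_of_isHalfJoined (u := u) (w := w) hu hw ha₀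
    (hpA u hu a₀ ha₀) (hpA w hw a₀ ha₀)
  have hHH' := fun u w hu hw => S.mirror.not_adj_of_isHalfJoined (u := u) (w := w) hu hw hc₀
    (hqC u hu c₀ hc₀) (hqC w hw c₀ hc₀)
  refine colorable_of_forall_exists (fun x n =>
    (x ∈ A ∧ n = iA x) ∨ (x ∈ C ∧ n = iC x) ∨ (x ∈ D ∧ n = k - 1) ∨ (x ∈ E ∧ n = k) ∨
    (x ∈ B ∧ n = k - iB x) ∨ (IsRemote G A B C D E x ∧ n = 0) ∨
    (IsHalfJoined G A B C D E x ∧ n = k) ∨ (IsHalfJoined G C B A E D x ∧ n = k - 1) ∨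
    (IsJoined G A B C D E x ∧ n = A.card + f x)) ?_ ?_
  · intro x
    rcases mem_or_isOutside A B C D E x with h | h | h | h | h | h
    · have := hiA x h
      exact ⟨iA x, by omega, .inl ⟨h, rfl⟩⟩
    · exact ⟨k - iB x, by omega, .inr (.inr (.inr (.inr (.inl ⟨h, rfl⟩))))⟩
    · have := hiC x h
      exact ⟨iC x, by omega, .inr (.inl ⟨h, rfl⟩)⟩
    · exact ⟨k - 1, by omega, .inr (.inr (.inl ⟨h, rfl⟩))⟩
    · exact ⟨k, le_rfl, .inr (.inr (.inr (.inl ⟨h, rfl⟩)))⟩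
    · rcases S.isRemote_or h with h | h | h | h
      · exact ⟨0, by omega, .inr (.inr (.inr (.inr (.inr (.inl ⟨h, rfl⟩)))))⟩
      · exact ⟨k, le_rfl, .inr (.inr (.inr (.inr (.inr (.inr (.inl ⟨h, rfl⟩))))))⟩
      · exact ⟨k - 1, by omega,
          .inr (.inr (.inr (.inr (.inr (.inr (.inr (.inl ⟨h, rfl⟩)))))))⟩
      · have := hf x h
        exact ⟨A.card + f x, by omega,
          .inr (.inr (.inr (.inr (.inr (.inr (.inr (.inr ⟨h, rfl⟩)))))))⟩
  · intro x y n hxy hx hy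
    have hyx := hxy.symm
    have hne := hxy.ne
    have hRA : ∀ u, IsRemote G A B C D E u → ∀ x ∈ A, ¬ G.Adj u x := fun _ h => h.notA
    have hRC : ∀ u, IsRemote G A B C D E u → ∀ x ∈ C, ¬ G.Adj u x := fun _ h => h.notC
    have hRD : ∀ u, IsRemote G A B C D E u → ∀ x ∈ D, ¬ G.Adj u x := fun _ h => h.notD
    have hRE : ∀ u, IsRemote G A B C D E u → ∀ x ∈ E, ¬ G.Adj u x := fun _ h => h.notE
    have hHB : ∀ u, IsHalfJoined G A B C D E u → ∀ x ∈ B, ¬ G.Adj u x := fun _ h => h.notB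
    have hHB' : ∀ u, IsHalfJoined G C B A E D u → ∀ x ∈ B, ¬ G.Adj u x := fun _ h => h.notB
    have hJB : ∀ u, IsJoined G A B C D E u → ∀ x ∈ B, ¬ G.Adj u x := fun _ h => h.notB
    have hAC := S.notAC
    have hDA := S.notDA
    have hBD := S.notBD
    have hCE := S.notCE
    have hEB := S.notEB
    clear hk S clA hD hE
    set a := A.card
    set b := B.card
    set c := C.card
    clear_value a b c
    rcases hx with hx | hx | hx | hx | hx | hx | hx | hx | hx <;>
    rcases hy with hy | hy | hy | hy | hy | hy | hy | hy | hy
    all_goals grind (splits := 20)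

end ClosedBlowup

open Classical in
/-- If the vertices outside a clique blowup of `C5` are isolated, then `G` lies in `𝒞`. -/
theorem inClassC_of_isolated [Fintype V] {A B C D E : Finset V} (S : C5Blowup G A B C D E)
    (h : ∀ u, IsOutside A B C D E u → ∀ w, ¬ G.Adj u w) : InClassC G := by
  let P : Fin 5 → Finset V := ![A, B, C, D, E]
  let O : Finset V := Finset.univ.filter (IsOutside A B C D E)
  have hO : ∀ u, u ∈ O ↔ IsOutside A B C D E u := by simp [O]
  have hP0 : ∀ i, 0 < (P i).card := by
    intro i
    have := S.neA.card_pos; have := S.neB.card_pos; have := S.neC.card_pos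
    have := S.neD.card_pos; have := S.neE.card_pos
    fin_cases i <;> assumption
  have hadj : ∀ i j, ∀ x ∈ P i, ∀ y ∈ P j, x ≠ y →
      (G.Adj x y ↔ i = j ∨ j = i + 1 ∨ i = j + 1) := by
    intro i j x hx y hy hxy
    obtain ⟨⟩ := S
    have := G.adj_comm x y
    fin_cases i <;> fin_cases j <;> simp [P] at hx hy ⊢ <;> grind
  have hdisj : ∀ i j, ∀ x ∈ P i, x ∈ P j → i = j := by
    intro i j x hx hy
    obtain ⟨a, ha⟩ := S.neA
    obtain ⟨b, hb⟩ := S.neB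
    obtain ⟨c, hc⟩ := S.neC
    obtain ⟨d, hd⟩ := S.neD
    obtain ⟨e, he⟩ := S.neE
    obtain ⟨⟩ := S
    have := G.adj_comm
    fin_cases i <;> fin_cases j <;> simp [P] at hx hy ⊢ <;> grind
  have hmem : ∀ u, (∃ i, u ∈ P i) ∨ u ∈ O := by
    intro u
    rcases ClosedBlowup.mem_or_isOutside A B C D E u with h | h | h | h | h | h
    exacts [.inl ⟨0, h⟩, .inl ⟨1, h⟩, .inl ⟨2, h⟩, .inl ⟨3, h⟩, .inl ⟨4, h⟩, .inr ((hO u).2 h)]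
  have hPO : ∀ i, ∀ x ∈ P i, x ∉ O := by
    intro i x hx hxO
    obtain ⟨h1, h2, h3, h4, h5⟩ := (hO x).1 hxO
    fin_cases i <;> contradiction
  let F : (Σ i : Fin 5, Fin (P i).card) ⊕ Fin O.card → V :=
    Sum.elim (fun p => ((P p.1).equivFin.symm p.2 : V)) fun q => (O.equivFin.symm q : V)
  have hFP : ∀ i p, F (.inl ⟨i, p⟩) ∈ P i := fun i p => ((P i).equivFin.symm p).2
  have hFO : ∀ q, F (.inr q) ∈ O := fun q => (O.equivFin.symm q).2
  have hinj : Function.Injective F := by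
    rintro (⟨i, p⟩ | p) (⟨j, q⟩ | q) hpq
    · obtain rfl : i = j := hdisj i j _ (hFP i p) (hpq ▸ hFP j q)
      obtain rfl : p = q := (P i).equivFin.symm.injective (Subtype.ext hpq)
      rfl
    · exact absurd (hpq ▸ hFO q) (hPO i _ (hFP i p))
    · exact absurd (hpq ▸ hFO p) (hPO j _ (hFP j q))
    · obtain rfl : p = q := O.equivFin.symm.injective (Subtype.ext hpq)
      rfl
  have hsurj : Function.Surjective F := by
    intro u
    rcases hmem u with ⟨i, hi⟩ | hu
    · exact ⟨.inl ⟨i, (P i).equivFin ⟨u, hi⟩⟩, by simp [F]⟩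
    · exact ⟨.inr (O.equivFin ⟨u, hu⟩), by simp [F]⟩
  refine ⟨fun i => (P i).card, O.card, hP0,
    ⟨(RelIso.mk (Equiv.ofBijective F ⟨hinj, hsurj⟩) ?_).symm⟩⟩
  intro x y
  change G.Adj (F x) (F y) ↔ _
  by_cases hxy : x = y
  · subst hxy
    simp
  have hne : F x ≠ F y := hinj.ne hxy
  rcases x with ⟨i, p⟩ | p
  · rcases y with ⟨j, q⟩ | q
    · rw [hadj i j _ (hFP i p) _ (hFP j q) hne]
      simp only [blowupC5, fromRel_adj, Sum.inl.injEq]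
      grind
    · have := h _ ((hO _).1 (hFO q)) (F (.inl ⟨i, p⟩))
      simp [blowupC5, G.adj_comm _ (F (.inr q)), this]
  · have := h _ ((hO _).1 (hFO p)) (F y)
    simp [blowupC5, this]

namespace ClosedBlowup

variable {A B C D E : Finset V}

theorem isJoined_mirror {u : V} (hu : IsJoined G A B C D E u) : IsJoined G C B A E D u :=
  ⟨hu.outside.mirror, hu.notB, hu.adjC, hu.adjA⟩

theorem not_isHalfJoined_of_one_lt_card_D (S : ClosedBlowup G A B C D E) (hD : 1 < D.card)
    (u : V) : ¬ IsHalfJoined G C B A E D u := by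
  intro hu
  obtain ⟨c, hc, uc⟩ := hu.exists_notA
  exact uc (S.adj_C_of_one_lt_card_D hD hu.outside.mirror hu.notB hu.adjC c hc)

theorem isolated_of_one_lt_card (S : ClosedBlowup G A B C D E) (hD : 1 < D.card)
    (hE : 1 < E.card) {u : V} (hu : IsOutside A B C D E u) (w : V) : ¬ G.Adj u w := by
  have key : ∀ v, IsOutside A B C D E v → IsRemote G A B C D E v := by
    intro v hv
    rcases S.isRemote_or hv with h | h | h | h
    · exact h
    · exact absurd h (S.mirror.not_isHalfJoined_of_one_lt_card_D hE v)
    · exact absurd h (S.not_isHalfJoined_of_one_lt_card_D hD v)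
    · obtain ⟨a, ha⟩ := S.neA
      obtain ⟨c, hc⟩ := S.neC
      obtain ⟨d, hd⟩ := S.neD
      obtain ⟨e, he⟩ := S.neE
      exact absurd ⟨h.adjC c hc, S.adj_D_of_one_lt_card_D hD hv h.notB h.adjC d hd,
        S.mirror.adj_D_of_one_lt_card_D hE hv.mirror h.notB h.adjA e he, h.adjA a ha,
        S.adjCD _ hc _ hd, S.adjDE _ hd _ he, S.adjEA _ he _ ha, S.notCE _ hc _ he,
        fun h => S.notAC _ ha _ hc h.symm, S.notDA _ hd _ ha⟩ (S.noGem v c d e a)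
  have hr := key u hu
  rcases mem_or_isOutside A B C D E w with h | h | h | h | h | h
  · exact hr.notA w h
  · exact S.not_adj_B_of_one_lt_card_D hD hu w h
  · exact hr.notC w h
  · exact hr.notD w h
  · exact hr.notE w h
  · exact S.not_adj_of_isRemote hr (key w h)

theorem colorable_of_card_eq_one [Fintype V] (S : ClosedBlowup G A B C D E) {k : ℕ}
    (hk : ∀ K : Finset V, G.IsClique (K : Set V) → K.card ≤ k) (hE : E.card = 1) :
    G.Colorable (k + 1) := by
  rcases (Nat.succ_le_of_lt S.neD.card_pos).eq_or_lt with hD | hD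
  · have hD1 : ∀ x ∈ D, ∀ y ∈ D, x = y := Finset.card_le_one.1 hD.ge
    have hE1 : ∀ x ∈ E, ∀ y ∈ E, x = y := Finset.card_le_one.1 hE.le
    by_cases hq : ∃ q, IsHalfJoined G C B A E D q
    · by_cases hp : ∃ p, IsHalfJoined G A B C D E p
      · obtain ⟨p, hp⟩ := hp
        obtain ⟨q, hq⟩ := hq
        rcases le_total C.card A.card with h | h
        · exact S.colorable_of_isHalfJoined hk hD.symm hE h hp hq
        · exact S.mirror.colorable_of_isHalfJoined hk hE hD.symm h hq hp
      · push Not at hp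
        exact S.mirror.colorable_of_card_E_eq_one hk hD.symm hp
          (fun u _ e he ue x hx => hE1 e he x hx ▸ ue) fun u _ e he ue x hx => hE1 e he x hx ▸ ue
    · push Not at hq
      exact S.colorable_of_card_E_eq_one hk hE hq
        (fun u _ d hd ud x hx => hD1 d hd x hx ▸ ud) fun u _ d hd ud x hx => hD1 d hd x hx ▸ ud
  · exact S.colorable_of_card_E_eq_one hk hE (S.not_isHalfJoined_of_one_lt_card_D hD)
      (fun u hu _ _ _ => S.adj_D_of_one_lt_card_D hD hu.outside hu.notB hu.adjC)
      fun u hu _ _ _ => S.adj_D_of_one_lt_card_D hD hu.outside hu.notB hu.adjC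

end ClosedBlowup

open Classical in
theorem exists_c5Blowup_of_embedding (φ : graphF1'' ↪g G) :
    ∃ A B C D E : Finset V, C5Blowup G A B C D E ∧ 2 ≤ A.card ∧ 2 ≤ C.card := by
  have hadj : ∀ i j, G.Adj (φ i) (φ j) ↔ graphF1''.Adj i j := fun i j => φ.map_rel_iff
  have h05 : φ 0 ≠ φ 5 := φ.injective.ne (by decide)
  have h26 : φ 2 ≠ φ 6 := φ.injective.ne (by decide)
  refine ⟨{φ 0, φ 5}, {φ 1}, {φ 2, φ 6}, {φ 3}, {φ 4}, ?_,
    (Finset.card_pair h05).ge, (Finset.card_pair h26).ge⟩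
  constructor <;> simp [hadj] <;> simp [graphF1'']

end FiveCycleBlowup

/-- A (P2+P3, gem)-free graph containing an induced `F1''` is in `𝒞` or satisfies
`χ(G) ≤ ω(G) + 1`. -/
theorem inClassC_or_chi_le_of_F1'' {V : Type*} [Fintype V] (G : SimpleGraph V)
    (h1 : IsFreeOf G graphP2P3) (h2 : IsFreeOf G graphGem)
    (hF : Nonempty (graphF1'' ↪g G)) :
    InClassC G ∨ G.chromaticNumber ≤ (G.cliqueNum : ℕ∞) + 1 := by
  have hg := noGem_of_isFreeOf h2
  have hp := noP2P3_of_isFreeOf h1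
  obtain ⟨φ⟩ := hF
  obtain ⟨A, B, C, D, E, S⟩ := exists_closedBlowup hg hp (exists_c5Blowup_of_embedding φ)
  have hk : ∀ K : Finset V, G.IsClique (K : Set V) → K.card ≤ G.cliqueNum :=
    fun K hK => hK.card_le_cliqueNum
  by_cases hDE : 1 < D.card ∧ 1 < E.card
  · exact .inl (inClassC_of_isolated S.toC5Blowup
      fun u hu => S.isolated_of_one_lt_card hDE.1 hDE.2 hu)
  · right
    have hD := S.neD.card_pos
    have hE := S.neE.card_pos
    have hcol : G.Colorable (G.cliqueNum + 1) := by
      by_cases h : E.card = 1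
      · exact S.colorable_of_card_eq_one hk h
      · exact S.mirror.colorable_of_card_eq_one hk (by omega)
    exact_mod_cast hcol.chromaticNumber_le
end
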